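/- arXiv:1306.6818 — 4 statements merged into one kernel-verified Lean document; each statement's English description precedes it below -/
import Mathlib

section
/- In PSL₂(F₁₃), the subgroup generated by the images of the matrices A = [[−5, 0], [0, 5]] and B = [[−2, −2], [−3, 3]] (both of determinant a nonzero square, hence lying in PSL₂(F₁₃)) is isomorphic to the alternating group A₄. -/
open Matrix

set_option synthInstance.maxHeartbeats 400000

instance : Fact (Nat.Prime 13) := ⟨by norm_num⟩

/-- `GL₂(F₁₃)`. -/
abbrev GL2F13 := GL (Fin 2) (ZMod 13)

/-- `PGL₂(F₁₃)`: the quotient of `GL₂(F₁₃)` by its center (the scalar matrices). -/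
abbrev PGL2F13 := GL2F13 ⧸ Subgroup.center GL2F13

/-- The quotient map `GL₂(F₁₃) → PGL₂(F₁₃)`. -/
noncomputable def projGL : GL2F13 →* PGL2F13 := QuotientGroup.mk' _

/-- The matrix `A = [[−5, 0], [0, 5]]` as an element of `GL₂(F₁₃)`. -/
noncomputable def matA : GL2F13 :=
  Matrix.GeneralLinearGroup.mkOfDetNeZero !![(-5 : ZMod 13), 0; 0, 5] (by decide)

/-- The matrix `B = [[−2, −2], [−3, 3]]` as an element of `GL₂(F₁₃)`. -/
noncomputable def matB : GL2F13 :=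
  Matrix.GeneralLinearGroup.mkOfDetNeZero !![(-2 : ZMod 13), -2; -3, 3] (by decide)

/-- Slopes of the four lines in `F₁₃²` that the images of `A` and `B` permute; each line is fixed
by an element of order three. -/
def tetraSlope : Fin 4 → ZMod 13 := ![10, 3, 9, 4]

/-- A matrix sending `(1, 0)`, `(0, 1)` and `(1, 1)` to multiples of the vectors
`(1, tetraSlope (g i))`, for `i = 0, 1, 2` respectively. -/
def tetraFrame (g : Equiv.Perm (Fin 4)) : Matrix (Fin 2) (Fin 2) (ZMod 13) :=
  let s := fun i => tetraSlope (g i)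
  !![s 1 - s 2, s 2 - s 0; (s 1 - s 2) * s 0, (s 2 - s 0) * s 1]

/-- A matrix sending the line of slope `tetraSlope i` to that of slope `tetraSlope (g i)`,
for `i = 0, 1, 2`. -/
def tetraMatrix (g : Equiv.Perm (Fin 4)) : Matrix (Fin 2) (Fin 2) (ZMod 13) :=
  tetraFrame g * !![tetraFrame 1 1 1, -tetraFrame 1 0 1; -tetraFrame 1 1 0, tetraFrame 1 0 0]

/-- The double transposition corresponding to `A`. -/
def permA : alternatingGroup (Fin 4) :=
  ⟨Equiv.swap 0 1 * Equiv.swap 2 3, Equiv.Perm.mem_alternatingGroup.2 (by decide)⟩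

/-- The three-cycle corresponding to `B`. -/
def permB : alternatingGroup (Fin 4) :=
  ⟨Equiv.swap 1 2 * Equiv.swap 2 3, Equiv.Perm.mem_alternatingGroup.2 (by decide)⟩

lemma tetraMatrix_det_ne_zero :
    ∀ g : alternatingGroup (Fin 4), (tetraMatrix g).det ≠ 0 := by
  simp only [Matrix.det_fin_two]
  decide +kernel

lemma tetraMatrix_mul :
    ∀ g h : alternatingGroup (Fin 4), ∃ c : ZMod 13,
      tetraMatrix (g * h : alternatingGroup (Fin 4)) = c • (tetraMatrix g * tetraMatrix h) := by
  decide +kernel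

lemma eq_one_of_tetraMatrix_scalar :
    ∀ g : alternatingGroup (Fin 4), tetraMatrix g 0 1 = 0 → tetraMatrix g 1 0 = 0 →
      tetraMatrix g 0 0 = tetraMatrix g 1 1 → g = 1 := by
  decide +kernel

lemma closure_permA_permB : Subgroup.closure {permA, permB} = ⊤ := by
  have normal_form : ∀ g : alternatingGroup (Fin 4), ∃ i j : Fin 3,
      g = permB ^ (i : ℕ) ∨ g = permB ^ (i : ℕ) * permA * permB ^ (j : ℕ) := by
    decide +kernel
  have hA : permA ∈ Subgroup.closure {permA, permB} := Subgroup.subset_closure (by simp)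
  have hB : permB ∈ Subgroup.closure {permA, permB} := Subgroup.subset_closure (by simp)
  refine (Subgroup.eq_top_iff' _).2 fun g => ?_
  obtain ⟨i, j, rfl | rfl⟩ := normal_form g
  · exact pow_mem hB _
  · exact mul_mem (mul_mem (pow_mem hB _) hA) (pow_mem hB _)

lemma projGL_eq_of_smul {x y : GL2F13} {c : ZMod 13}
    (h : (x : Matrix (Fin 2) (Fin 2) (ZMod 13)) = c • (y : Matrix (Fin 2) (Fin 2) (ZMod 13))) :
    projGL x = projGL y := by
  refine (QuotientGroup.eq (s := Subgroup.center GL2F13)).2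
    (inv_mem_iff.1 (Subgroup.mem_center_iff.2 fun z => ?_))
  have hyx : ((y⁻¹ * x : GL2F13) : Matrix (Fin 2) (Fin 2) (ZMod 13)) = c • 1 := by
    rw [Units.val_mul, h, mul_smul_comm, ← Units.val_mul, inv_mul_cancel, Units.val_one]
  rw [_root_.mul_inv_rev, inv_inv]
  ext1
  rw [Units.val_mul z, Units.val_mul _ z, hyx, mul_smul_comm, smul_mul_assoc, mul_one, one_mul]

/-- The matrix `tetraMatrix g` as an element of `GL₂(F₁₃)`. -/
noncomputable def tetraGL (g : alternatingGroup (Fin 4)) : GL2F13 :=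
  Matrix.GeneralLinearGroup.mkOfDetNeZero (tetraMatrix g) (tetraMatrix_det_ne_zero g)

/-- The tetrahedral embedding of `A₄` into `PGL₂(F₁₃)`. -/
noncomputable def tetraHom : alternatingGroup (Fin 4) →* PGL2F13 :=
  MonoidHom.mk' (fun g => projGL (tetraGL g)) fun g h => by
    obtain ⟨c, hc⟩ := tetraMatrix_mul g h
    rw [← map_mul]
    exact projGL_eq_of_smul hc

lemma tetraHom_injective : Function.Injective tetraHom := by
  refine (injective_iff_map_eq_one _).2 fun g hg => ?_
  have hc : tetraGL g ∈ Subgroup.center GL2F13 := (QuotientGroup.eq_one_iff _).1 hg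
  have comm (z : Matrix (Fin 2) (Fin 2) (ZMod 13)) (hz : z.det ≠ 0) :
      z * tetraMatrix g = tetraMatrix g * z :=
    congrArg Units.val
      (Subgroup.mem_center_iff.1 hc (Matrix.GeneralLinearGroup.mkOfDetNeZero z hz))
  have upper := comm !![1, 1; 0, 1] (by simp)
  have lower := comm !![1, 0; 1, 1] (by simp)
  have h00 := congrFun (congrFun upper 0) 0
  have h01 := congrFun (congrFun upper 0) 1
  have h00' := congrFun (congrFun lower 0) 0
  simp [Matrix.mul_apply, Fin.sum_univ_two] at h00 h01 h00'
  refine eq_one_of_tetraMatrix_scalar g h00' h00 ?_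
  linear_combination -h01

lemma tetraHom_permA : tetraHom permA = projGL matA := by
  have h : ∃ c : ZMod 13, tetraMatrix permA = c • !![(-5 : ZMod 13), 0; 0, 5] := by
    decide +kernel
  exact projGL_eq_of_smul h.choose_spec

lemma tetraHom_permB : tetraHom permB = projGL matB := by
  have h : ∃ c : ZMod 13, tetraMatrix permB = c • !![(-2 : ZMod 13), -2; -3, 3] := by
    decide +kernel
  exact projGL_eq_of_smul h.choose_spec

/-- In `PGL₂(F₁₃)`, the subgroup generated by the images of the matrices
`A = [[−5, 0], [0, 5]]` and `B = [[−2, −2], [−3, 3]]` is isomorphic to the alternating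
group `A₄`. -/
theorem closure_image_A_B_iso_A4 :
    Nonempty (↥(Subgroup.closure {projGL matA, projGL matB}) ≃* alternatingGroup (Fin 4)) := by
  have hrange : tetraHom.range = Subgroup.closure {projGL matA, projGL matB} := by
    rw [MonoidHom.range_eq_map, ← closure_permA_permB, MonoidHom.map_closure, Set.image_pair,
      tetraHom_permA, tetraHom_permB]
  rw [← hrange]
  exact ⟨(MonoidHom.ofInjective tetraHom_injective).symm⟩
end

section
/- Let K be any subgroup of PGL₂(F₁₃) which is isomorphic to the symmetric group S₄. Then the intersection K ∩ PSL₂(F₁₃) is isomorphic to the alternating group A₄. -/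
open Matrix

set_option synthInstance.maxHeartbeats 400000

/-- `PSL₂(F₁₃)`: the image of `SL₂(F₁₃)` in `PGL₂(F₁₃)`. -/
noncomputable def PSL2F13 : Subgroup PGL2F13 :=
  Subgroup.map projGL (Matrix.SpecialLinearGroup.toGL (n := Fin 2) (R := ZMod 13)).range

theorem projGL_eq_one_iff (g : GL2F13) :
    projGL g = 1 ↔ ∃ r, g.val = Matrix.scalar (Fin 2) r := by
  rw [projGL, QuotientGroup.mk'_apply, QuotientGroup.eq_one_iff,
    Matrix.GeneralLinearGroup.mem_center_iff_val_mem_range_scalar]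
  simp only [Set.mem_range, eq_comm]

/-- The square of any element of `PGL₂(F₁₃)` lies in `PSL₂(F₁₃)`. -/
theorem sq_mem_PSL2F13 (x : PGL2F13) : x ^ 2 ∈ PSL2F13 := by
  obtain ⟨g, rfl⟩ := QuotientGroup.mk'_surjective _ x
  change projGL g ^ 2 ∈ PSL2F13
  set δ : (ZMod 13)ˣ := Matrix.GeneralLinearGroup.det g with hδ
  let z : GL2F13 := Matrix.GeneralLinearGroup.scalar (Fin 2) δ
  have hz : projGL z = 1 := (projGL_eq_one_iff z).2 ⟨δ, rfl⟩
  have hdet : (z⁻¹ * g ^ 2).val.det = 1 := by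
    have hz2 : Matrix.GeneralLinearGroup.det z = δ ^ 2 :=
      Matrix.GeneralLinearGroup.det_scalar δ
    have h : Matrix.GeneralLinearGroup.det (z⁻¹ * g ^ 2) = 1 := by
      rw [map_mul, map_inv, map_pow, hz2, ← hδ, inv_mul_cancel]
    simpa using congrArg Units.val h
  refine ⟨z⁻¹ * g ^ 2, ⟨⟨_, hdet⟩, Units.ext rfl⟩, ?_⟩
  rw [map_mul, map_inv, hz, map_pow, inv_one, one_mul]

/-- `PSL₂(F₁₃)` has no element of order four, because `2` is not a square modulo `13`. -/
theorem sq_eq_one_of_mem_PSL2F13 {x : PGL2F13} (hx : x ∈ PSL2F13) (h : x ^ 4 = 1) :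
    x ^ 2 = 1 := by
  obtain ⟨_, ⟨A, rfl⟩, rfl⟩ := hx
  rw [← map_pow, ← map_pow, projGL_eq_one_iff] at h ⊢
  obtain ⟨r, hr⟩ := h
  have hd := A.det_coe
  rw [Matrix.det_fin_two] at hd
  replace hr : A.val ^ 4 = Matrix.scalar (Fin 2) r := by simpa using hr
  suffices hs : ∃ s, A.val ^ 2 = Matrix.scalar (Fin 2) s by simpa using hs
  generalize A.val = M at *
  have two_ne_sq : ∀ t : ZMod 13, t ^ 2 - 2 ≠ 0 := by decide
  have ht := two_ne_sq (M 0 0 + M 1 1)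
  have h00 := congrFun₂ hr 0 0
  have h01 := congrFun₂ hr 0 1
  have h10 := congrFun₂ hr 1 0
  have h11 := congrFun₂ hr 1 1
  simp [pow_succ, Matrix.mul_apply, Fin.sum_univ_two] at h00 h01 h10 h11
  have e01 : M 0 1 * (M 0 0 + M 1 1) = 0 := by
    apply mul_right_cancel₀ ht
    grind
  have e10 : M 1 0 * (M 0 0 + M 1 1) = 0 := by
    apply mul_right_cancel₀ ht
    grind
  have ed : (M 0 0 - M 1 1) * (M 0 0 + M 1 1) = 0 := by
    apply mul_right_cancel₀ ht
    grind
  refine ⟨(M ^ 2) 0 0, ?_⟩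
  ext i j
  fin_cases i <;> fin_cases j <;>
    simp [pow_succ, Matrix.mul_apply, Fin.sum_univ_two] <;> grind

/-- A subgroup of `S₄` containing all squares but missing the standard four-cycle is `A₄`. -/
theorem eq_alternatingGroup_four {H : Subgroup (Equiv.Perm (Fin 4))}
    (hsq : ∀ σ, σ ^ 2 ∈ H) (hrot : finRotate 4 ∉ H) : H = alternatingGroup (Fin 4) := by
  have hle : alternatingGroup (Fin 4) ≤ H := by
    rw [← Equiv.Perm.closure_three_cycles_eq_alternating, Subgroup.closure_le]
    intro σ hσ
    have h3 : σ ^ 3 = 1 := hσ.orderOf ▸ pow_orderOf_eq_one σ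
    have h4 : (σ ^ 2) ^ 2 = σ := by rw [← pow_mul, pow_succ, h3, one_mul]
    exact h4 ▸ hsq _
  refine le_antisymm (fun σ hσ => ?_) hle
  rw [Equiv.Perm.mem_alternatingGroup]
  refine (Int.units_eq_one_or _).resolve_right fun hodd => hrot ?_
  refine (H.mul_mem_cancel_left (H.inv_mem hσ)).1 (hle ?_)
  rw [Equiv.Perm.mem_alternatingGroup, map_mul, map_inv, hodd, sign_finRotate]
  decide

/-- If `K` is any subgroup of `PGL₂(F₁₃)` isomorphic to the symmetric group `S₄`, then the
intersection `K ∩ PSL₂(F₁₃)` is isomorphic to the alternating group `A₄`. -/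
theorem inf_PSL_iso_A4 (K : Subgroup PGL2F13) (hK : Nonempty (K ≃* Equiv.Perm (Fin 4))) :
    Nonempty (↥(K ⊓ PSL2F13) ≃* alternatingGroup (Fin 4)) := by
  obtain ⟨e⟩ := hK
  let f : Equiv.Perm (Fin 4) →* PGL2F13 := K.subtype.comp e.symm.toMonoidHom
  have hf : Function.Injective f := K.subtype_injective.comp e.symm.injective
  have hrange : f.range = K := by
    ext x
    exact ⟨fun ⟨σ, hσ⟩ => hσ ▸ (e.symm σ).2, fun hx => ⟨e ⟨x, hx⟩, by simp [f]⟩⟩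
  have hcomap : PSL2F13.comap f = alternatingGroup (Fin 4) := by
    refine eq_alternatingGroup_four (fun σ => ?_) fun hrot => ?_
    · rw [Subgroup.mem_comap, map_pow]
      exact sq_mem_PSL2F13 _
    · have h4 : f (finRotate 4) ^ 4 = 1 := by
        rw [← map_pow, show finRotate 4 ^ 4 = 1 by decide, map_one]
      have h2 := sq_eq_one_of_mem_PSL2F13 hrot h4
      rw [← map_pow, map_eq_one_iff f hf] at h2
      exact absurd h2 (by decide)
  have hmap : (alternatingGroup (Fin 4)).map f = K ⊓ PSL2F13 := by
    rw [← hcomap, Subgroup.map_comap_eq, hrange]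
  exact ⟨((Subgroup.equivMapOfInjective _ f hf).trans (MulEquiv.subgroupCongr hmap)).symm⟩
end

section
/- Let P(X) = (X² + 5X + 13)·(X⁴ + 7X³ + 20X² + 19X + 1)³ ∈ ℚ[X], and let F(X) = P(X) − (11225615440/1594323)·X. Then the Galois group of F over ℚ (the Galois group of its splitting field over ℚ) is isomorphic to the symmetric group S₄. -/
open Polynomial

/-- The polynomial `P(X) = (X² + 5X + 13)·(X⁴ + 7X³ + 20X² + 19X + 1)³` expressing the
`j`-invariant in terms of the Hauptmodul of `X₀(13)`, as `j = P(t)/t`. -/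
noncomputable def P13 : Polynomial ℚ :=
  (X ^ 2 + 5 * X + 13) * (X ^ 4 + 7 * X ^ 3 + 20 * X ^ 2 + 19 * X + 1) ^ 3

/-- `F(X) = P(X) − (11225615440/1594323)·X`. -/
noncomputable def F12 : Polynomial ℚ := P13 - C (11225615440 / 1594323 : ℚ) * X

/-- The root of `octicFactor` attached to a root `a` of `quartic` and a square root `s` of `13`. -/
noncomputable def octicRoot {L : Type*} [Field L] (a s : L) : L :=
  -95 / 84 + 1 / 84 * a - 1 / 84 * a ^ 2 + 1 / 84 * a ^ 3 +
    (23 / 84 + 1 / 28 * a - 1 / 28 * a ^ 2 + 9 / 1820 * a ^ 3) * s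

/-- The polynomial recovering `a` from `octicRoot a s`. -/
noncomputable def octicRootInverse : ℚ[X] :=
  -(C (137781 / 5811416) * X ^ 7 + C (193185 / 447032) * X ^ 6 + C (78003 / 23528) * X ^ 5 +
    C (10081503 / 726427) * X ^ 4 + C (191836971 / 5811416) * X ^ 3 +
    C (245355705 / 5811416) * X ^ 2 + C (146899191 / 5811416) * X + C (33349067 / 2905708))

/-- The root of `sexticFactor` attached to a root `y` of `X ^ 6 - 219700 X ^ 2 - 37129300`. -/
noncomputable def sexticRoot {L : Type*} [Field L] (y : L) : L :=
  -9 / 14 + 71 / 182 * y + 1 / 273 * y ^ 2 + 53 / 70980 * y ^ 3 - 1 / 230685 * y ^ 4 -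
    11 / 3998540 * y ^ 5

/-- A root of `octicFactor` expressed through `a` and `s`, and `a` and `s` expressed through it. -/
theorem octic_relations {L : Type*} [Field L] [CharZero L] {a s b : L}
    (ha : a ^ 4 + 130 * a + 325 = 0) (hs : s ^ 2 = 13) (hb : b = octicRoot a s) :
    729 + 5397155 / 2187 * b + 3351866 / 729 * b ^ 2 + 1041025 / 243 * b ^ 3 +
    185330 / 81 * b ^ 4 + 6775 / 9 * b ^ 5 + 154 * b ^ 6 + 55 / 3 * b ^ 7 + b ^ 8 = 0 ∧
    -33349067 / 2905708 - 146899191 / 5811416 * b - 245355705 / 5811416 * b ^ 2 -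
    191836971 / 5811416 * b ^ 3 - 10081503 / 726427 * b ^ 4 - 78003 / 23528 * b ^ 5 -
    193185 / 447032 * b ^ 6 - 137781 / 5811416 * b ^ 7 = a ∧
    10595365 / 5811416 + 44160627 / 2905708 * b + 18028800 / 726427 * b ^ 2 +
    5444523 / 341848 * b ^ 3 + 96795 / 17992 * b ^ 4 + 1463103 / 1452854 * b ^ 5 +
    280665 / 2905708 * b ^ 6 + 19683 / 5811416 * b ^ 7 = s := by
  unfold octicRoot at hb
  have h2 : b ^ 2 = -1201 / 252 - 251 / 252 * a + 23 / 84 * a ^ 2 - 107 / 1260 * a ^ 3 +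
      (-305 / 252 + 1 / 252 * a + 41 / 252 * a ^ 2 - 71 / 3276 * a ^ 3) * s := by
    rw [pow_succ, pow_one, hb]
    linear_combination (529 / 7056 + 23 / 1176 * a - 43 / 2352 * a ^ 2 + 1 / 6370 * a ^ 3 +
      83 / 50960 * a ^ 4 - 9 / 25480 * a ^ 5 + 81 / 3312400 * a ^ 6) * hs + (127 / 5880 -
      43 / 8820 * a + 527 / 1146600 * a ^ 2 + (139 / 76440 - 37 / 38220 * a +
      3 / 25480 * a ^ 2) * s) * ha
  have h3 : b ^ 3 = 12875 / 378 + 1069 / 189 * a - 197 / 126 * a ^ 2 + 2 / 7 * a ^ 3 +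
      (2467 / 378 - 1 / 63 * a - 25 / 42 * a ^ 2 + 404 / 4095 * a ^ 3) * s := by
    rw [pow_succ, h2, hb]
    linear_combination (-7015 / 21168 - 223 / 5292 * a + 1861 / 21168 * a ^ 2 -
      215 / 34398 * a ^ 3 - 3011 / 458640 * a ^ 4 + 181 / 114660 * a ^ 5 -
      71 / 662480 * a ^ 6) * hs + (-179 / 1764 + 164 / 6615 * a - 827 / 343980 * a ^ 2 +
      (-38 / 1911 + 566 / 85995 * a - 583 / 859950 * a ^ 2) * s) * ha
  have h4 : b ^ 4 = -48179 / 324 - 7097 / 324 * a + 745 / 108 * a ^ 2 - 83 / 108 * a ^ 3 +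
      (-70835 / 2268 - 4301 / 2268 * a + 3895 / 2268 * a ^ 2 - 11449 / 29484 * a ^ 3) * s := by
    rw [pow_succ, h3, hb]
    linear_combination (56741 / 31752 + 269 / 1176 * a - 2099 / 5292 * a ^ 2 +
      3319 / 85995 * a ^ 3 + 1133 / 45864 * a ^ 4 - 1483 / 229320 * a ^ 5 +
      101 / 207025 * a ^ 6) * hs + (133 / 324 - 401 / 3780 * a + 19 / 1950 * a ^ 2 + (2341 / 22932
      - 9011 / 343980 * a + 89 / 34398 * a ^ 2) * s) * ha
  have h5 : b ^ 5 = 3597725 / 6804 + 150415 / 2268 * a - 170965 / 6804 * a ^ 2 +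
      14725 / 6804 * a ^ 3 + (913657 / 6804 + 13745 / 756 * a - 2797 / 756 * a ^ 2 +
      569753 / 442260 * a ^ 3) * s := by
    rw [pow_succ, h4, hb]
    linear_combination (-1629205 / 190512 - 77857 / 47628 * a + 289187 / 190512 * a ^ 2 -
      20387 / 154791 * a ^ 3 - 349129 / 4127760 * a ^ 4 + 355 / 15876 * a ^ 5 -
      11449 / 5962320 * a ^ 6) * hs + (-691361 / 476280 + 1516 / 3969 * a - 70403 / 2063880 * a ^ 2
      + (-2660989 / 6191640 + 13409 / 154791 * a - 52153 / 6191640 * a ^ 2) * s) * ha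
  have h6 : b ^ 6 = -1177138 / 729 - 118279 / 729 * a + 52096 / 729 * a ^ 2 -
      10082 / 1215 * a ^ 3 + (-379145 / 729 - 74591 / 729 * a + 394 / 81 * a ^ 2 -
      11254 / 3159 * a ^ 3) * s := by
    rw [pow_succ, h5, hb]
    linear_combination (21014111 / 571536 + 931031 / 95256 * a - 982945 / 190512 * a ^ 2 +
      1092731 / 4643730 * a ^ 3 + 3319343 / 12383280 * a ^ 4 - 79631 / 1238328 * a ^ 5 +
      569753 / 89434800 * a ^ 6) * hs + (821419 / 178605 - 165869 / 142884 * a +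
      5042239 / 46437300 * a ^ 2 + (14659997 / 9287460 - 2423357 / 9287460 * a +
      60458 / 2321865 * a ^ 2) * s) * ha
  have h7 : b ^ 7 = 120975 / 28 + 21375061 / 61236 * a - 94369 / 756 * a ^ 2 +
      2400889 / 61236 * a ^ 3 + (107842411 / 61236 + 25086863 / 61236 * a + 32189 / 61236 * a ^ 2 +
      10682089 / 1326780 * a ^ 3) * s := by
    rw [pow_succ, h6, hb]
    linear_combination (-8720335 / 61236 - 713257 / 15309 * a + 9215 / 567 * a ^ 2 +
      12413 / 44226 * a ^ 3 - 356873 / 442260 * a ^ 4 + 16727 / 110565 * a ^ 5 -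
      5627 / 319410 * a ^ 6) * hs + (-292427 / 21870 + 446449 / 153090 * a - 15533 / 47385 * a ^ 2
      + (-9889781 / 1990170 + 71083 / 94770 * a - 138391 / 1658475 * a ^ 2) * s) * ha
  have h8 : b ^ 8 = -630588199 / 61236 - 165504167 / 183708 * a - 21341947 / 183708 * a ^ 2 -
      32075599 / 183708 * a ^ 3 + (-128276315 / 26244 - 9966703 / 8748 * a - 339497 / 26244 * a ^ 2 -
      1762667 / 113724 * a ^ 3) * s := by
    rw [pow_succ, h7, hb]
    linear_combination (2480375453 / 5143824 + 450262541 / 2571912 * a -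
      247526297 / 5143824 * a ^ 2 - 25767754 / 6965595 * a ^ 3 + 255735749 / 111449520 * a ^ 4 -
      5292761 / 18574920 * a ^ 5 + 10682089 / 268304400 * a ^ 6) * hs + (462153221 / 12859560 -
      36373397 / 6429780 * a + 822769067 / 835871400 * a ^ 2 + (99915677 / 7960680 -
      5032231 / 2388204 * a + 461287 / 1592136 * a ^ 2) * s) * ha
  refine ⟨?_, ?_, ?_⟩
  · rw [h8, h7, h6, h5, h4, h3, h2, hb]; ring
  · rw [h7, h6, h5, h4, h3, h2, hb]; ring
  · rw [h7, h6, h5, h4, h3, h2, hb]; ring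

/-- A root of `sexticFactor` expressed through `y`, and `y` expressed through it. -/
theorem sextic_relations {L : Type*} [Field L] [CharZero L] {y c : L}
    (hy : y ^ 6 - 219700 * y ^ 2 - 37129300 = 0)
    (hc : c = sexticRoot y) :
    13 / 729 - 2113 / 243 * c + 4058 / 81 * c ^ 2 + 1523 / 27 * c ^ 3 + 274 / 9 * c ^ 4 +
    23 / 3 * c ^ 5 + c ^ 6 = 0 ∧
    1187693 / 49997 - 55134759 / 199988 * c - 30079251 / 99994 * c ^ 2 -
    31281363 / 199988 * c ^ 3 - 1930716 / 49997 * c ^ 4 - 967869 / 199988 * c ^ 5 = y := by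
  unfold sexticRoot at hc
  have h2 : c ^ 2 = 83 / 42 - 2441 / 1638 * y + 4 / 819 * y ^ 2 - 653 / 212940 * y ^ 3 -
      11 / 692055 * y ^ 4 + 391 / 35986860 * y ^ 5 := by
    rw [pow_succ, pow_one, hc]
    linear_combination (919 / 21832028400 - 109 / 4093505325 * y - 1741 / 425724553800 * y ^ 2 +
      11 / 461201599950 * y ^ 3 + 121 / 15988322131600 * y ^ 4) * hy
  have h3 : c ^ 3 = -4435 / 189 + 323 / 117 * y - 25 / 273 * y ^ 2 + 134 / 22815 * y ^ 3 +
      209 / 830466 * y ^ 4 - 79 / 3855735 * y ^ 5 := by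
    rw [pow_succ, h2, hc]
    linear_combination (-117457 / 196488255600 + 1 / 35986860 * y + 379 / 22806672525 * y ^ 2 -
      1 / 296486742825 * y ^ 3 - 4301 / 143894899184400 * y ^ 4) * hy
  have h4 : c ^ 4 = 122377 / 1134 + 8207 / 4914 * y + 320 / 819 * y ^ 2 + 3343 / 638820 * y ^ 3 -
      6856 / 6228495 * y ^ 4 - 5027 / 323881740 * y ^ 5 := by
    rw [pow_succ, h3, hc]
    linear_combination (368447 / 147366191700 + 33337 / 98244127800 * y -
      62353 / 1915760492100 * y ^ 2 - 30061 / 49809772794600 * y ^ 3 +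
      869 / 15417310626900 * y ^ 4) * hy
  have h5 : c ^ 5 = -625927 / 3402 - 476965 / 14742 * y - 380 / 567 * y ^ 2 -
      480133 / 5749380 * y ^ 3 + 14083 / 7474194 * y ^ 4 + 259849 / 971645220 * y ^ 5 := by
    rw [pow_succ, h4, hc]
    linear_combination (-5458799 / 1768394300400 - 72811 / 36841547925 * y -
      13547 / 638586830700 * y ^ 2 + 9251 / 2988586367676 * y ^ 3 +
      55297 / 1295054092659600 * y ^ 4) * hy
  have h6 : c ^ 6 = -371869 / 567 + 1132790 / 9477 * y - 9208 / 5103 * y ^ 2 +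
      38162 / 123201 * y ^ 3 + 315529 / 56056455 * y ^ 4 - 2291 / 2313441 * y ^ 5 := by
    rw [pow_succ, h5, hc]
    linear_combination (-12290113 / 589464766800 + 1471 / 320322600 * y +
      2075219 / 4926241265400 * y ^ 2 - 406199 / 64041136450200 * y ^ 3 -
      2858339 / 3885162277978800 * y ^ 4) * hy
  refine ⟨?_, ?_⟩
  · rw [h6, h5, h4, h3, h2, hc]; ring
  · rw [h5, h4, h3, h2, hc]; ring

/-- A quartic whose splitting field is the splitting field of `F12`. -/
noncomputable def quartic : ℚ[X] := X ^ 4 + 130 * X + 325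

/-- The cubic resolvent of `quartic`. -/
noncomputable def resolventCubic : ℚ[X] := X ^ 3 - 1300 * X - 16900

/-- The factor of degree six of `F12`. -/
noncomputable def sexticFactor : ℚ[X] :=
  X ^ 6 + C (23 / 3) * X ^ 5 + C (274 / 9) * X ^ 4 + C (1523 / 27) * X ^ 3 +
    C (4058 / 81) * X ^ 2 - C (2113 / 243) * X + C (13 / 729)

/-- The factor of degree eight of `F12`. -/
noncomputable def octicFactor : ℚ[X] :=
  X ^ 8 + C (55 / 3) * X ^ 7 + C 154 * X ^ 6 + C (6775 / 9) * X ^ 5 + C (185330 / 81) * X ^ 4 +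
    C (1041025 / 243) * X ^ 3 + C (3351866 / 729) * X ^ 2 + C (5397155 / 2187) * X + C 729

theorem F12_eq_sexticFactor_mul_octicFactor : F12 = sexticFactor * octicFactor := by
  refine Polynomial.funext fun x => ?_
  simp only [F12, P13, sexticFactor, octicFactor, eval_add, eval_sub, eval_mul, eval_pow, eval_X,
    eval_C, eval_ofNat, eval_one]
  ring

theorem quartic_monic : quartic.Monic := by
  unfold quartic; monicity!

theorem quartic_natDegree : quartic.natDegree = 4 := by
  unfold quartic; compute_degree!

theorem resolventCubic_monic : resolventCubic.Monic := by
  unfold resolventCubic; monicity!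

theorem resolventCubic_natDegree : resolventCubic.natDegree = 3 := by
  unfold resolventCubic; compute_degree!

theorem sexticFactor_natDegree : sexticFactor.natDegree = 6 := by
  unfold sexticFactor; compute_degree!

theorem octicFactor_natDegree : octicFactor.natDegree = 8 := by
  unfold octicFactor; compute_degree!

theorem sexticFactor_ne_zero : sexticFactor ≠ 0 :=
  ne_zero_of_natDegree_gt (n := 0) (by rw [sexticFactor_natDegree]; norm_num)

theorem octicFactor_ne_zero : octicFactor ≠ 0 :=
  ne_zero_of_natDegree_gt (n := 0) (by rw [octicFactor_natDegree]; norm_num)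

theorem quartic_irreducible : Irreducible quartic := by
  set f : ℤ[X] := X ^ 4 + C 130 * X + C 325 with hf
  have hfm : f.Monic := by rw [hf]; monicity!
  have hdeg : f.natDegree = 4 := by rw [hf]; compute_degree!
  have hmap : quartic = f.map (algebraMap ℤ ℚ) := by simp [quartic, hf]
  rw [hmap, ← hfm.irreducible_iff_irreducible_map_fraction_map]
  refine irreducible_of_eisenstein_criterion (P := Ideal.span {13}) ?_ ?_ ?_ ?_ ?_
    hfm.isPrimitive
  · rw [Ideal.span_singleton_prime (by norm_num)]
    exact Int.prime_iff_natAbs_prime.2 (by norm_num)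
  · rw [hfm.leadingCoeff, Ideal.mem_span_singleton]
    norm_num
  · intro n hn
    rw [degree_eq_natDegree hfm.ne_zero, hdeg] at hn
    have hn4 : n < 4 := by exact_mod_cast hn
    rw [Ideal.mem_span_singleton]
    interval_cases n <;> simp [hf, coeff_X, coeff_X_pow]
  · rw [← natDegree_pos_iff_degree_pos, hdeg]
    norm_num
  · rw [Ideal.span_singleton_pow, Ideal.mem_span_singleton]
    simp [hf]

theorem resolventCubic_irreducible : Irreducible resolventCubic := by
  set f : ℤ[X] := X ^ 3 - C 1300 * X - C 16900 with hf
  have hfm : f.Monic := by rw [hf]; monicity!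
  have hmap : resolventCubic = f.map (algebraMap ℤ ℚ) := by simp [resolventCubic, hf]
  rw [hmap, ← hfm.irreducible_iff_irreducible_map_fraction_map]
  refine hfm.irreducible_of_irreducible_map (Int.castRingHom (ZMod 3)) f ?_
  have hdeg : (f.map (Int.castRingHom (ZMod 3))).natDegree = 3 := by
    rw [hfm.natDegree_map, hf]; compute_degree!
  refine irreducible_of_degree_le_three_of_not_isRoot (by simp [hdeg]) fun x => ?_
  simp only [hf, IsRoot, Polynomial.map_sub, Polynomial.map_mul, Polynomial.map_pow, map_X,
    map_C, eval_sub, eval_mul, eval_pow, eval_X, eval_C]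
  revert x
  decide

instance fact_prime_nineteen : Fact (Nat.Prime 19) := ⟨by norm_num⟩

theorem exists_padicInt_root : ∃ z : ℚ_[19], z ^ 4 + 130 * z + 325 = 0 := by
  obtain ⟨z, hz, -⟩ := hensels_lemma (p := 19) (R := ℤ)
    (F := X ^ 4 + 130 * X + 325) (a := 1) (by
      have h1 : ‖((456 : ℤ) : ℤ_[19])‖ < 1 := by
        rw [PadicInt.norm_int_lt_one_iff_dvd]; norm_num
      have h2 : ‖((134 : ℤ) : ℤ_[19])‖ = 1 := by
        refine le_antisymm (PadicInt.norm_le_one _) (not_lt.1 ?_)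
        rw [PadicInt.norm_int_lt_one_iff_dvd]; norm_num
      have e1 : aeval (1 : ℤ_[19]) (X ^ 4 + 130 * X + 325 : ℤ[X]) = ((456 : ℤ) : ℤ_[19]) := by
        simp [map_ofNat]; norm_num
      have e2 : aeval (1 : ℤ_[19]) (derivative (X ^ 4 + 130 * X + 325 : ℤ[X])) =
          ((134 : ℤ) : ℤ_[19]) := by
        simp [map_ofNat]; norm_num
      rw [e1, e2, h2]
      simpa using h1)
  refine ⟨z, ?_⟩
  have : z ^ 4 + 130 * z + 325 = 0 := by simpa [map_ofNat] using hz
  exact_mod_cast congrArg (fun t : ℤ_[19] => (t : ℚ_[19])) this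

theorem padic_sq_ne_thirteen (x : ℚ_[19]) : x ^ 2 ≠ 13 := by
  intro hx
  have hnorm : ‖x‖ ≤ 1 := by
    have h13 : ‖(13 : ℚ_[19])‖ ≤ 1 := by
      simpa using Padic.norm_int_le_one (p := 19) 13
    rw [← hx, norm_pow] at h13
    exact (pow_le_one_iff_of_nonneg (norm_nonneg x) two_ne_zero).1 h13
  obtain ⟨z, rfl⟩ : ∃ z : ℤ_[19], (z : ℚ_[19]) = x := ⟨⟨x, hnorm⟩, rfl⟩
  have hz : z ^ 2 = 13 := by
    apply Subtype.ext
    exact_mod_cast hx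
  have hmod := congrArg (PadicInt.toZMod (p := 19)) hz
  rw [map_pow, map_ofNat] at hmod
  exact (by decide : ∀ t : ZMod 19, t ^ 2 ≠ 13) _ hmod

theorem minpoly_eq_quartic {L : Type*} [Field L] [CharZero L] [Algebra ℚ L] {a : L}
    (ha : a ^ 4 + 130 * a + 325 = 0) : minpoly ℚ a = quartic :=
  (minpoly.eq_of_irreducible_of_monic quartic_irreducible (by simpa [quartic, map_ofNat] using ha)
    quartic_monic).symm

theorem nonempty_algHom_adjoin {F E M : Type*} [Field F] [Field E] [Field M] [Algebra F E]
    [Algebra F M] {a : E} (ha : IsIntegral F a) {z : M} (hz : aeval z (minpoly F a) = 0) :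
    Nonempty (IntermediateField.adjoin F {a} →ₐ[F] M) :=
  ⟨(IntermediateField.adjoin.powerBasis ha).lift z (by
    rwa [IntermediateField.adjoin.powerBasis_gen, IntermediateField.minpoly_gen])⟩

theorem sq_ne_thirteen_of_mem_adjoin {L : Type*} [Field L] [CharZero L] [Algebra ℚ L] {a : L}
    (ha : a ^ 4 + 130 * a + 325 = 0) (x : IntermediateField.adjoin ℚ {a}) : x ^ 2 ≠ 13 := by
  have ha_integral : IsIntegral ℚ a :=
    ⟨quartic, quartic_monic, by simpa [quartic, ← aeval_def, map_ofNat] using ha⟩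
  obtain ⟨z, hz⟩ := exists_padicInt_root
  obtain ⟨φ⟩ := nonempty_algHom_adjoin ha_integral (z := z) (by
      rw [minpoly_eq_quartic ha]
      simpa [quartic, map_ofNat] using hz)
  intro hx
  refine padic_sq_ne_thirteen (φ x) ?_
  rw [← map_pow, hx, map_ofNat]

theorem finrank_dvd_of_roots {L : Type*} [Field L] [CharZero L] [Algebra ℚ L]
    [FiniteDimensional ℚ L] {a s t : L} (ha : a ^ 4 + 130 * a + 325 = 0) (hs : s ^ 2 = 13)
    (ht : t ^ 3 - 1300 * t - 16900 = 0) : 24 ∣ Module.finrank ℚ L := by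
  have h3 : 3 ∣ Module.finrank ℚ L := by
    have h := minpoly.degree_dvd (K := ℚ) (L := L) (x := t) (IsIntegral.of_finite ℚ t)
    rwa [← minpoly.eq_of_irreducible_of_monic resolventCubic_irreducible
      (by simpa [resolventCubic, map_ofNat] using ht) resolventCubic_monic,
      resolventCubic_natDegree] at h
  have h8 : 8 ∣ Module.finrank ℚ L := by
    set K := IntermediateField.adjoin ℚ {a}
    have hK : Module.finrank ℚ K = 4 := by
      rw [IntermediateField.adjoin.finrank (IsIntegral.of_finite ℚ a), minpoly_eq_quartic ha,
        quartic_natDegree]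
    have hirr : Irreducible (X ^ 2 - 13 : K[X]) := by
      have hdeg : (X ^ 2 - 13 : K[X]).natDegree = 2 := by compute_degree!
      refine irreducible_of_degree_le_three_of_not_isRoot (by simp [hdeg]) fun x hx => ?_
      exact sq_ne_thirteen_of_mem_adjoin ha x (sub_eq_zero.1 (by simpa using hx))
    have hmin : minpoly K s = X ^ 2 - 13 :=
      (minpoly.eq_of_irreducible_of_monic hirr (by simp [hs, map_ofNat]) (by monicity!)).symm
    have h2 := minpoly.degree_dvd (K := K) (L := L) (x := s) (IsIntegral.of_finite K s)
    have hdeg : (X ^ 2 - 13 : K[X]).natDegree = 2 := by compute_degree!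
    rw [hmin, hdeg] at h2
    rw [← Module.finrank_mul_finrank ℚ K L, hK]
    exact mul_dvd_mul_left 4 h2
  exact Nat.Coprime.mul_dvd_of_dvd_of_dvd (by norm_num : Nat.Coprime 3 8) h3 h8

theorem splits_of_injective_of_isRoot {L ι : Type*} [Field L] [Fintype ι] {p : L[X]}
    (hp : p ≠ 0) {f : ι → L} (hf : Function.Injective f) (hroot : ∀ i, p.IsRoot (f i))
    (hcard : p.natDegree ≤ Fintype.card ι) : p.Splits := by
  classical
  rw [splits_iff_card_roots]
  refine le_antisymm (card_roots' p) (hcard.trans ?_)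
  rw [← Finset.card_univ, ← Finset.card_image_of_injective Finset.univ hf]
  refine (Finset.card_le_card fun x hx => ?_).trans (Multiset.toFinset_card_le _)
  obtain ⟨i, -, rfl⟩ := Finset.mem_image.1 hx
  simpa [hp] using hroot i

/-- The roots of `quartic` in a field where it splits, with the elementary symmetric relations and
a square root of `13`. -/
theorem exists_quartic_roots {L : Type*} [Field L] [CharZero L] [Algebra ℚ L]
    (h : (quartic.map (algebraMap ℚ L)).Splits) :
    ∃ a b c d s : L, quartic.map (algebraMap ℚ L) =
        (X - C a) * ((X - C b) * ((X - C c) * (X - C d))) ∧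
      a + b + c + d = 0 ∧ a * b + a * c + a * d + b * c + b * d + c * d = 0 ∧
      a * b * c + a * b * d + a * c * d + b * c * d = -130 ∧ a * b * c * d = 325 ∧
      s ^ 2 = 13 ∧
      9100 * s = ((a + b) ^ 2 - (a + c) ^ 2) * ((a + c) ^ 2 - (b + c) ^ 2) *
        ((b + c) ^ 2 - (a + b) ^ 2) := by
  have hcard : Multiset.card (quartic.map (algebraMap ℚ L)).roots = 4 := by
    rw [← h.natDegree_eq_card_roots, natDegree_map, quartic_natDegree]
  obtain ⟨a, b, c, d, hroots⟩ := Multiset.card_eq_four.1 hcard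
  have hprod := h.eq_prod_roots_of_monic (quartic_monic.map _)
  rw [hroots] at hprod
  have hprod' : quartic.map (algebraMap ℚ L) =
      (X - C a) * ((X - C b) * ((X - C c) * (X - C d))) := by simpa using hprod
  have key : (X ^ 4 + C 130 * X + C 325 : L[X]) = X ^ 4 - C (a + b + c + d) * X ^ 3 +
      C (a * b + a * c + a * d + b * c + b * d + c * d) * X ^ 2 -
      C (a * b * c + a * b * d + a * c * d + b * c * d) * X + C (a * b * c * d) := by
    have : quartic.map (algebraMap ℚ L) = X ^ 4 + C 130 * X + C 325 := by
      simp [quartic, map_ofNat C]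
    rw [← this, hprod']
    simp only [map_add, map_mul]
    ring
  have hcoeff (n : ℕ) := congrArg (fun p => coeff p n) key
  simp only [coeff_add, coeff_sub, coeff_C_mul, coeff_X_pow, coeff_X, coeff_C] at hcoeff
  have e1 : a + b + c + d = 0 := by
    have := hcoeff 3
    norm_num at this
    linear_combination this
  have e2 : a * b + a * c + a * d + b * c + b * d + c * d = 0 := by
    simpa using (hcoeff 2).symm
  have e3 : a * b * c + a * b * d + a * c * d + b * c * d = -130 := by
    have := hcoeff 1
    norm_num at this
    linear_combination this
  have e4 : a * b * c * d = 325 := by simpa using (hcoeff 0).symm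
  refine ⟨a, b, c, d, ((a + b) ^ 2 - (a + c) ^ 2) * ((a + c) ^ 2 - (b + c) ^ 2) *
        ((b + c) ^ 2 - (a + b) ^ 2) / 9100, hprod', e1, e2, e3, e4, ?_, by ring⟩
  obtain rfl : d = -a - b - c := by linear_combination e1
  have hsum : (a + b) ^ 2 + (a + c) ^ 2 + (b + c) ^ 2 = 0 := by linear_combination -2 * e2
  have hpair : (a + b) ^ 2 * (a + c) ^ 2 + (a + b) ^ 2 * (b + c) ^ 2 +
      (a + c) ^ 2 * (b + c) ^ 2 = -1300 := by
    linear_combination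
      (a * b + a * c + a * (-a - b - c) + b * c + b * (-a - b - c) + c * (-a - b - c)) * e2 - 4 * e4
  have hmul : (a + b) ^ 2 * (a + c) ^ 2 * (b + c) ^ 2 = 16900 := by
    linear_combination (a * b * c + a * b * (-a - b - c) + a * c * (-a - b - c) +
      b * c * (-a - b - c) - 130) * e3
  generalize (a + b) ^ 2 = u at hsum hpair hmul ⊢
  generalize (a + c) ^ 2 = v at hsum hpair hmul ⊢
  generalize (b + c) ^ 2 = w at hsum hpair hmul ⊢
  obtain rfl : w = -(u + v) := eq_neg_of_add_eq_zero_right hsum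
  have h1 : u ^ 2 + u * v + v ^ 2 = 1300 := by linear_combination -hpair
  have h2 : u * v * (u + v) = -16900 := by linear_combination -hmul
  linear_combination (4 * ((u ^ 2 + u * v + v ^ 2) ^ 2 + 1300 * (u ^ 2 + u * v + v ^ 2) +
    1300 ^ 2) * h1 - 27 * (u * v * (u + v) - 16900) * h2) / 9100 ^ 2

section

variable {L : Type*} [Field L] [CharZero L] [Algebra ℚ L]

set_option maxRecDepth 2000 in
theorem aeval_octicRoot {a s : L} (ha : a ^ 4 + 130 * a + 325 = 0) (hs : s ^ 2 = 13) :
    aeval (octicRoot a s) octicFactor = 0 := by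
  have h := (octic_relations (b := octicRoot a s) ha hs rfl).1
  simp only [octicFactor, map_add, map_mul, map_pow, aeval_X, aeval_C, eq_ratCast]
  push_cast
  linear_combination h

set_option maxRecDepth 2000 in
theorem aeval_octicRoot_octicRootInverse {a s : L} (ha : a ^ 4 + 130 * a + 325 = 0)
    (hs : s ^ 2 = 13) : aeval (octicRoot a s) octicRootInverse = a := by
  have h := (octic_relations (b := octicRoot a s) ha hs rfl).2.1
  simp only [octicRootInverse, map_add, map_neg, map_mul, map_pow, aeval_X, aeval_C, eq_ratCast]
  push_cast
  linear_combination h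

omit [Algebra ℚ L] in
theorem eq_of_octicRoot_eq {a s a' s' : L} (ha : a ^ 4 + 130 * a + 325 = 0) (hs : s ^ 2 = 13)
    (ha' : a' ^ 4 + 130 * a' + 325 = 0) (hs' : s' ^ 2 = 13)
    (h : octicRoot a s = octicRoot a' s') : a = a' ∧ s = s' := by
  obtain ⟨-, h1, h2⟩ := octic_relations ha hs rfl
  obtain ⟨-, h1', h2'⟩ := octic_relations ha' hs' h
  exact ⟨h1.symm.trans h1', h2.symm.trans h2'⟩

theorem octicFactor_splits {r : Fin 4 → L} (hr : Function.Injective r)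
    (hroot : ∀ i, r i ^ 4 + 130 * r i + 325 = 0) {s : L} (hs : s ^ 2 = 13) :
    (octicFactor.map (algebraMap ℚ L)).Splits := by
  have hs0 : s ≠ 0 := by rintro rfl; norm_num at hs
  have hσ : Function.Injective ![s, -s] := by
    intro i j h
    fin_cases i <;> fin_cases j <;> simp_all [self_eq_neg, neg_eq_self]
  have hσs : ∀ i, ![s, -s] i ^ 2 = 13 := by
    intro i
    fin_cases i <;> simp [hs]
  refine splits_of_injective_of_isRoot (ι := Fin 4 × Fin 2)
    (f := fun i => octicRoot (r i.1) (![s, -s] i.2)) ?_ ?_ ?_ ?_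
  · exact Polynomial.map_ne_zero octicFactor_ne_zero
  · intro i j h
    obtain ⟨h1, h2⟩ := eq_of_octicRoot_eq (hroot _) (hσs _) (hroot _) (hσs _) h
    exact Prod.ext (hr h1) (hσ h2)
  · intro i
    rw [IsRoot, eval_map_algebraMap]
    exact aeval_octicRoot (hroot _) (hσs _)
  · simp [octicFactor_natDegree]

theorem sexticFactor_splits {ι : Type*} [Fintype ι] (hι : Fintype.card ι = 6) {y : ι → L}
    (hy : Function.Injective y)
    (hroot : ∀ i, y i ^ 6 - 219700 * y i ^ 2 - 37129300 = 0) :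
    (sexticFactor.map (algebraMap ℚ L)).Splits := by
  refine splits_of_injective_of_isRoot (f := fun i => sexticRoot (y i)) ?_ ?_ ?_ ?_
  · exact Polynomial.map_ne_zero sexticFactor_ne_zero
  · intro i j h
    exact hy ((sextic_relations (hroot i) rfl).2.symm.trans (sextic_relations (hroot j) h).2)
  · intro i
    have h := (sextic_relations (hroot i) rfl).1
    rw [IsRoot, eval_map_algebraMap]
    simp only [sexticFactor, map_add, map_sub, map_mul, map_pow, aeval_X, aeval_C, eq_ratCast]
    push_cast
    linear_combination h
  · simp [sexticFactor_natDegree, hι]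

omit [Algebra ℚ L] in
theorem injective_signed {ι : Type*} {w : ι → L} {s : L} (hw : Function.Injective fun i => w i ^ 2)
    (hw0 : ∀ i, w i ≠ 0) (hs : s ≠ 0) :
    Function.Injective fun i : ι × Fin 2 => w i.1 * ![s, -s] i.2 := by
  rintro ⟨i, e⟩ ⟨j, e'⟩ h
  have hsq (e : Fin 2) : ![s, -s] e ^ 2 = s ^ 2 := by fin_cases e <;> simp
  have hij : i = j := by
    refine hw (mul_right_cancel₀ (pow_ne_zero 2 hs) ?_)
    have := congrArg (· ^ 2) h
    simpa [mul_pow, hsq] using this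
  subst hij
  have h' : ![s, -s] e = ![s, -s] e' := mul_left_cancel₀ (hw0 i) h
  refine Prod.ext rfl ?_
  revert h'
  fin_cases e <;> fin_cases e' <;> simp [self_eq_neg, neg_eq_self, hs]

omit [CharZero L] [Algebra ℚ L] in
theorem pairSum_root {x y z : L} (h2 : x * y + x * z + y * z - (x + y + z) ^ 2 = 0)
    (h3 : x * y * z - (x * y + x * z + y * z) * (x + y + z) = -130)
    (h4 : x * y * z * (x + y + z) = -325) :
    ((x + y) ^ 2) ^ 3 - 1300 * (x + y) ^ 2 - 16900 = 0 := by
  linear_combination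
    (-2 * (x + y) ^ 4 - (x * y + x * z + y * z - (x + y + z) ^ 2) * (x + y) ^ 2) * h2 +
    (x * y * z - (x * y + x * z + y * z) * (x + y + z) - 130) * h3 - 4 * (x + y) ^ 2 * h4

/-- A splitting field of `quartic` is a splitting field of `F12` and has degree `24`. -/
theorem isSplittingField_F12_and_dvd_finrank [IsSplittingField ℚ L quartic] :
    IsSplittingField ℚ L F12 ∧ 24 ∣ Module.finrank ℚ L := by
  have := IsSplittingField.finiteDimensional L quartic
  obtain ⟨a, b, c, d, s, hprod, e1, e2, e3, e4, hs, hΔ⟩ :=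
    exists_quartic_roots (IsSplittingField.splits L quartic)
  have hs0 : s ≠ 0 := by rintro rfl; norm_num at hs
  have hroot (x : L) : x ^ 4 + 130 * x + 325 = (x - a) * ((x - b) * ((x - c) * (x - d))) := by
    have := congrArg (eval x) hprod
    simpa [quartic] using this
  have ha : a ^ 4 + 130 * a + 325 = 0 := by rw [hroot]; ring
  have hb : b ^ 4 + 130 * b + 325 = 0 := by rw [hroot]; ring
  have hc : c ^ 4 + 130 * c + 325 = 0 := by rw [hroot]; ring
  have hd : d ^ 4 + 130 * d + 325 = 0 := by rw [hroot]; ring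
  have hr : ∀ i, ![a, b, c, d] i ^ 4 + 130 * ![a, b, c, d] i + 325 = 0 := by
    intro i
    fin_cases i <;> assumption
  have hd' : d = -a - b - c := by linear_combination e1
  have hab : ((a + b) ^ 2) ^ 3 - 1300 * (a + b) ^ 2 - 16900 = 0 := by
    subst hd'
    exact pairSum_root (x := a) (y := b) (z := c) (by linear_combination e2)
      (by linear_combination e3) (by linear_combination -e4)
  have hac : ((a + c) ^ 2) ^ 3 - 1300 * (a + c) ^ 2 - 16900 = 0 := by
    subst hd'
    exact pairSum_root (x := a) (y := c) (z := b) (by linear_combination e2)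
      (by linear_combination e3) (by linear_combination -e4)
  have hbc : ((b + c) ^ 2) ^ 3 - 1300 * (b + c) ^ 2 - 16900 = 0 := by
    subst hd'
    exact pairSum_root (x := b) (y := c) (z := a) (by linear_combination e2)
      (by linear_combination e3) (by linear_combination -e4)
  have hΔ0 : ((a + b) ^ 2 - (a + c) ^ 2) * ((a + c) ^ 2 - (b + c) ^ 2) *
      ((b + c) ^ 2 - (a + b) ^ 2) ≠ 0 := by
    rw [← hΔ]
    exact mul_ne_zero (by norm_num) hs0
  have hrinj : Function.Injective ![a, b, c, d] := by
    have hfac : (b - c) * (a - d) * ((a - b) * (c - d)) * ((c - a) * (b - d)) ≠ 0 := by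
      convert! hΔ0 using 1
      rw [hd']
      ring
    simp only [mul_ne_zero_iff, sub_ne_zero] at hfac
    obtain ⟨⟨⟨hbc', had'⟩, hab', hcd'⟩, hca', hbd'⟩ := hfac
    intro i j h
    fin_cases i <;> fin_cases j <;> simp_all [eq_comm]
  have hw : Function.Injective fun i => ![a + b, a + c, b + c] i ^ 2 := by
    simp only [mul_ne_zero_iff, sub_ne_zero] at hΔ0
    obtain ⟨⟨h1, h2⟩, h3⟩ := hΔ0
    intro i j h
    fin_cases i <;> fin_cases j <;> first | rfl | exact absurd h ‹_› | exact absurd h.symm ‹_›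
  have hw3 : ∀ i, (![a + b, a + c, b + c] i ^ 2) ^ 3 - 1300 * ![a + b, a + c, b + c] i ^ 2
      - 16900 = 0 := by
    intro i
    fin_cases i <;> assumption
  have hw0 : ∀ i, ![a + b, a + c, b + c] i ≠ 0 := by
    intro i h0
    have := hw3 i
    rw [h0] at this
    norm_num at this
  have h8 := octicFactor_splits hrinj hr hs
  have h6 := sexticFactor_splits (by simp) (injective_signed hw hw0 hs0) (by
    rintro ⟨i, e⟩
    have hsq : ![s, -s] e ^ 2 = 13 := by fin_cases e <;> simp [hs]
    have hwi := hw3 i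
    generalize ![s, -s] e = σ at hsq ⊢
    generalize ![a + b, a + c, b + c] i = w at hwi ⊢
    linear_combination 2197 * hwi + (w ^ 6 * (σ ^ 4 + 13 * σ ^ 2 + 169) - 219700 * w ^ 2) * hsq)
  refine ⟨⟨?_, ?_⟩, finrank_dvd_of_roots ha hs hab⟩
  · rw [F12_eq_sexticFactor_mul_octicFactor, Polynomial.map_mul]
    exact h6.mul h8
  · rw [eq_top_iff, ← IsSplittingField.adjoin_rootSet L quartic, Algebra.adjoin_le_iff]
    intro x hx
    have hx' : x ^ 4 + 130 * x + 325 = 0 := by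
      simpa [quartic, map_ofNat] using (mem_rootSet.1 hx).2
    rw [SetLike.mem_coe, ← aeval_octicRoot_octicRootInverse hx' hs]
    refine Algebra.adjoin_mono (Set.singleton_subset_iff.2 ?_) (aeval_mem_adjoin_singleton ℚ _)
    rw [mem_rootSet, F12_eq_sexticFactor_mul_octicFactor, map_mul, aeval_octicRoot hx' hs,
      mul_zero]
    exact ⟨mul_ne_zero sexticFactor_ne_zero octicFactor_ne_zero, rfl⟩

theorem gal_F12_equiv_of_isSplittingField [IsSplittingField ℚ L quartic] :
    Nonempty (F12.Gal ≃* Equiv.Perm (Fin 4)) := by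
  have hsplits := IsSplittingField.splits L quartic
  have : Fact ((quartic.map (algebraMap ℚ L)).Splits) := ⟨hsplits⟩
  have := IsSplittingField.finiteDimensional L quartic
  have := IsGalois.of_separable_splitting_field (F := ℚ) (E := L) quartic_irreducible.separable
  obtain ⟨hF, hdvd⟩ := isSplittingField_F12_and_dvd_finrank (L := L)
  let e : F12.Gal ≃* quartic.Gal := (IsSplittingField.algEquiv L F12).symm.autCongr.trans
    (IsSplittingField.algEquiv L quartic).autCongr
  have hcard : Nat.card (quartic.rootSet L) = 4 := by
    rw [Nat.card_eq_fintype_card, card_rootSet_eq_natDegree quartic_irreducible.separable hsplits,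
      quartic_natDegree]
  have hinj := Gal.galActionHom_injective quartic L
  have hperm : Nat.card (Equiv.Perm (quartic.rootSet L)) = 24 := by
    rw [Nat.card_perm, hcard]; rfl
  have hcongr : Nat.card (L ≃ₐ[ℚ] L) = Nat.card quartic.Gal :=
    Nat.card_congr (IsSplittingField.algEquiv L quartic).autCongr.toEquiv
  have hgal : Nat.card quartic.Gal = 24 := by
    refine le_antisymm (hperm ▸ Nat.card_le_card_of_injective _ hinj)
      (Nat.le_of_dvd Nat.card_pos ?_)
    rwa [← hcongr, IsGalois.card_aut_eq_finrank]
  have hbij := (Nat.bijective_iff_injective_and_card _).2 ⟨hinj, hgal.trans hperm.symm⟩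
  exact ⟨e.trans ((MulEquiv.ofBijective _ hbij).trans
    (Finite.equivFinOfCardEq hcard).permCongrHom)⟩

end

/-- The Galois group over `ℚ` of `F(X) = P(X) − (11225615440/1594323)·X` is isomorphic to the
symmetric group `S₄`. -/
theorem gal_F12_iso_S4 : Nonempty (F12.Gal ≃* Equiv.Perm (Fin 4)) :=
  @gal_F12_equiv_of_isSplittingField quartic.SplittingField _ _ _
    (IsSplittingField.splittingField quartic)
end

section
/- Let P(X) = (X² + 5X + 13)·(X⁴ + 7X³ + 20X² + 19X + 1)³ ∈ ℚ[X], and let F(X) = P(X) + (160855552000/1594323)·X. Then the Galois group of F over ℚ (the Galois group of its splitting field over ℚ) is isomorphic to the symmetric group S₄. -/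
open Polynomial

/-- `F(X) = P(X) + (160855552000/1594323)·X`. -/
noncomputable def F13 : Polynomial ℚ := P13 + C (160855552000 / 1594323 : ℚ) * X

section Roots

variable {E : Type*} [Field E] [CharZero E]

theorem exists_quartic_root_of_octic_factor {y w : E} (hw : w ^ 2 - 13 = 0)
    (h : y ^ 4 + y ^ 3 * w + 21 * y ^ 3 + 67 / 2 * y ^ 2 * w + 477 / 2 * y ^ 2 + 382 * y * w + 1124
      * y + 2875 / 2 * w + 11251 / 2 = 0) :
    ∃ a : E, a ^ 4 + 13 * a ^ 3 + 65 * a ^ 2 + 169 * a + 221 = 0 ∧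
      y = 1 / 26 * a ^ 3 * w + 5 / 2 * a ^ 3 + 1 / 2 * a ^ 2 * w + 41 / 2 * a ^ 2 + 2 * a * w + 66 *
        a + 3 * w + 115 := by
  obtain ⟨a, ha⟩ : ∃ a : E, a = -5 / 12116 * y ^ 3 * w + 13 / 1864 * y ^ 3 - 989 / 48464 * y ^ 2 * w
    + 377 / 3728 * y ^ 2 - 2203 / 12116 * y * w + 1627 / 1864 * y - 25411 / 48464 * w -
    18249 / 3728 := ⟨_, rfl⟩
  have ha2 : a ^ 2 = -271 / 48464 * y ^ 3 * w - 137 / 3728 * y ^ 3 - 1483 / 48464 * y ^ 2 * w - 2103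
    / 3728 * y ^ 2 - 4487 / 48464 * y * w - 21125 / 3728 * y + 76677 / 48464 * w +
    24905 / 3728 := by
    rw [ha]
    linear_combination (25 / 146797456 * y ^ 2 * w ^ 2 - 5 / 868624 * y ^ 2 * w + 169 / 3474496 *
    y ^ 2 - 25 / 146797456 * y * w ^ 3 + 5585 / 293594912 * y * w ^ 2 - 257 / 868624 * y * w + 169
    / 434312 * y + 25 / 146797456 * w ^ 4 - 3105 / 146797456 * w ^ 3 + 1444769 / 2348759296 * w ^
    2 - 20511 / 11292112 * w + 36543 / 13897984) * h + (-25 / 146797456 * y ^ 3 * w ^ 3 + 6835 /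
    293594912 * y ^ 3 * w ^ 2 - 1960869 / 2348759296 * y ^ 3 * w + 801731 / 180673792 * y ^ 3 -
    1675 / 293594912 * y ^ 2 * w ^ 3 + 107605 / 146797456 * y ^ 2 * w ^ 2 - 107836883 / 4697518592
    * y ^ 2 * w + 27856363 / 361347584 * y ^ 2 - 4775 / 73398728 * y * w ^ 3 + 2387895 / 293594912
    * y * w ^ 2 - 280012569 / 1174379648 * y * w + 13938441 / 22584224 * y - 71875 / 293594912 * w
    ^ 3 + 270175 / 9174841 * w ^ 2 - 3609711195 / 4697518592 * w - 5324233 / 27795968) * hw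
  have key : a ^ 4 + 13 * a ^ 3 + 65 * a ^ 2 + 169 * a + 221 =
      (a ^ 2) ^ 2 + 13 * a * a ^ 2 + 65 * a ^ 2 + 169 * a + 221 := by ring
  refine ⟨a, ?_, ?_⟩
  · rw [key, ha2, ha]
    linear_combination (143901 / 2348759296 * y ^ 2 * w ^ 2 + 4569 / 45168448 * y ^ 2 * w - 27537
    / 13897984 * y ^ 2 - 143901 / 2348759296 * y * w ^ 3 + 176763 / 293594912 * y * w ^ 2 +
    1999117 / 180673792 * y * w - 28469 / 1737248 * y + 143901 / 2348759296 * w ^ 4 - 6425733 /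
    4697518592 * w ^ 3 - 84109643 / 4697518592 * w ^ 2 + 31011709 / 361347584 * w - 3362403 /
    27795968) * h + (-143901 / 2348759296 * y ^ 3 * w ^ 3 + 5011629 / 2348759296 * y ^ 3 * w ^ 2 +
    6097235 / 361347584 * y ^ 3 * w - 68422143 / 361347584 * y ^ 3 - 9641367 / 4697518592 * y ^ 2
    * w ^ 3 + 513123285 / 9395037184 * y ^ 2 * w ^ 2 + 234943939 / 361347584 * y ^ 2 * w -
    2434586257 / 722695168 * y ^ 2 - 27485091 / 1174379648 * y * w ^ 3 + 2544855933 / 4697518592 *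
    y * w ^ 2 + 2728974149 / 361347584 * y * w - 5114930175 / 180673792 * y - 413715375 /
    4697518592 * w ^ 3 + 15235922073 / 9395037184 * w ^ 2 + 11667482533 / 361347584 * w -
    7113802697 / 722695168) * hw
  · rw [show a ^ 3 = a * a ^ 2 by ring, ha2, ha]
    linear_combination (-1355 / 15266935424 * y ^ 2 * w ^ 3 - 11397 / 2348759296 * y ^ 2 * w ^ 2 +
    6273 / 90336896 * y ^ 2 * w + 8905 / 13897984 * y ^ 2 + 1355 / 15266935424 * y * w ^ 4 + 8651
    / 4697518592 * y * w ^ 3 - 1372745 / 4697518592 * y * w ^ 2 - 836275 / 361347584 * y * w +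
    157625 / 27795968 * y - 1355 / 15266935424 * w ^ 5 - 44713 / 61067741696 * w ^ 4 + 5689735 /
    15266935424 * w ^ 3 + 3083401 / 1174379648 * w ^ 2 - 225009 / 11292112 * w + 1381585 /
    27795968) * h + (1355 / 15266935424 * y ^ 3 * w ^ 4 - 23037 / 61067741696 * y ^ 3 * w ^ 3 -
    49478495 / 122135483392 * y ^ 3 * w ^ 2 + 2220181 / 4697518592 * y ^ 3 * w + 40362775 /
    722695168 * y ^ 3 + 90785 / 30533870848 * y ^ 2 * w ^ 4 + 110787 / 9395037184 * y ^ 2 * w ^ 3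
    - 1581323451 / 122135483392 * y ^ 2 * w ^ 2 - 560649891 / 9395037184 * y ^ 2 * w + 732159871 /
    722695168 * y ^ 2 + 258805 / 7633467712 * y * w ^ 4 + 3845299 / 15266935424 * y * w ^ 3 -
    17617795441 / 122135483392 * y * w ^ 2 - 586996157 / 587189824 * y * w + 6233892737 /
    722695168 * y + 3895625 / 30533870848 * w ^ 4 + 189530295 / 122135483392 * w ^ 3 - 64726314037
    / 122135483392 * w ^ 2 - 4205139119 / 722695168 * w + 7045211097 / 722695168) * hw

theorem octic_factor_of_quartic_root {a w y : E} (hw : w ^ 2 - 13 = 0)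
    (h : a ^ 4 + 13 * a ^ 3 + 65 * a ^ 2 + 169 * a + 221 = 0)
    (hy : y = 1 / 26 * a ^ 3 * w + 5 / 2 * a ^ 3 + 1 / 2 * a ^ 2 * w + 41 / 2 * a ^ 2 + 2 * a * w +
      66 * a + 3 * w + 115) :
    y ^ 4 + y ^ 3 * w + 21 * y ^ 3 + 67 / 2 * y ^ 2 * w + 477 / 2 * y ^ 2 + 382 * y * w + 1124 * y +
      2875 / 2 * w + 11251 / 2 = 0 := by
  have hy2 : y ^ 2 = 87 / 26 * a ^ 3 * w - 75 / 2 * a ^ 3 + 51 / 2 * a ^ 2 * w - 619 / 2 * a ^ 2 +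
    72 * a * w - 992 * a + 241 / 2 * w - 3593 / 2 := by
    rw [hy]
    linear_combination (1 / 676 * a ^ 2 * w ^ 2 + 5 / 26 * a ^ 2 * w + 25 / 4 * a ^ 2 + 1 / 52 * a
    * w ^ 2 + 41 / 26 * a * w + 85 / 4 * a + 3 / 52 * w ^ 2 + 67 / 26 * w + 271 / 4) * h + (-1 /
    52 * a ^ 3 - 17 / 52 * a ^ 2 - 2 * a - 15 / 4) * hw
  rw [show y ^ 4 = (y ^ 2) ^ 2 by ring, show y ^ 3 = y * y ^ 2 by ring, hy2, hy]
  linear_combination (87 / 676 * a ^ 2 * w ^ 3 + 3519 / 169 * a ^ 2 * w ^ 2 - 10365 / 52 * a ^ 2 *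
  w - 1125 / 2 * a ^ 2 + 51 / 52 * a * w ^ 3 + 746 / 13 * a * w ^ 2 - 41573 / 52 * a * w - 3735 /
  2 * a + 57 / 52 * w ^ 3 + 2012 / 13 * w ^ 2 - 104207 / 52 * w - 12529 / 2) * h + (25 / 13 * a ^
  3 * w + 723 / 26 * a ^ 3 + 199 / 13 * a ^ 2 * w + 6623 / 26 * a ^ 2 + 55 * a * w + 951 * a + 477
  / 4 * w + 3117 / 2) * hw

theorem octic_eq_mul {w : E} (hw : w ^ 2 - 13 = 0) (y : E) :
    y ^ 8 + 42 * y ^ 7 + 905 * y ^ 6 + 11394 * y ^ 5 + 90820 * y ^ 4 + 402322 * y ^ 3 + 797665 * y ^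
      2 - 1631126 * y + 4782969 =
      (y ^ 4 + y ^ 3 * w + 21 * y ^ 3 + 67 / 2 * y ^ 2 * w + 477 / 2 * y ^ 2 + 382 * y * w + 1124 *
        y + 2875 / 2 * w + 11251 / 2) *
      (y ^ 4 - y ^ 3 * w + 21 * y ^ 3 - 67 / 2 * y ^ 2 * w + 477 / 2 * y ^ 2 - 382 * y * w + 1124 *
        y - 2875 / 2 * w + 11251 / 2) := by
  linear_combination (y ^ 6 + 67 * y ^ 5 + 7545 / 4 * y ^ 4 + 28469 * y ^ 3 + 484473 / 2 * y ^ 2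
    + 1098250 * y + 8265625 / 4) * hw

theorem quartic_root_eq_of_octic_trace {a u : E}
    (h : a ^ 4 + 13 * a ^ 3 + 65 * a ^ 2 + 169 * a + 221 = 0)
    (hu : u = 5 * a ^ 3 + 41 * a ^ 2 + 132 * a + 230) :
    a = -1 / 19724 * u ^ 3 + 135 / 9862 * u ^ 2 + 4241 / 9862 * u + 40867 / 19724 := by
  have hu2 : u ^ 2 = -149 * a ^ 3 - 1221 * a ^ 2 - 3864 * a - 6991 := by
    rw [hu]
    linear_combination (25 * a ^ 2 + 85 * a + 271) * h
  rw [show u ^ 3 = u * u ^ 2 by ring, hu2, hu]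
  linear_combination (-745 / 19724 * a ^ 2 - 2529 / 19724 * a - 7747 / 19724) * h

theorem exists_resolvent_root_of_sextic {y : E}
    (h : y ^ 6 + 36 * y ^ 5 + 508 * y ^ 4 + 3486 * y ^ 3 + 13236 * y ^ 2 + 33884 * y + 13 = 0) :
    ∃ r : E, r ^ 3 - 65 * r ^ 2 + 1313 * r - 8450 = 0 ∧
      (y - (4 / 13 * r ^ 2 - 15 * r + 155)) ^ 2 =
        (-50 / 24167 * r ^ 2 + 10 / 143 * r - 994 / 1859) ^ 2 * (13 * r ^ 2 - 182 * r - 7943) := by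
  obtain ⟨r, hr⟩ : ∃ r : E, r = -4 / 36115 * y ^ 5 + 99 / 36115 * y ^ 4 + 4128 / 36115 * y ^ 3 +
    44238 / 36115 * y ^ 2 + 35468 / 7223 * y + 1187953 / 36115 := ⟨_, rfl⟩
  have hr2 : r ^ 2 = -202 / 36115 * y ^ 5 + 30 / 233 * y ^ 4 + 198212 / 36115 * y ^ 3 + 2124509 /
    36115 * y ^ 2 + 8526484 / 36115 * y + 39074867 / 36115 := by
    rw [hr]
    linear_combination (16 / 1304293225 * y ^ 4 - 1368 / 1304293225 * y ^ 3 + 17897 / 1304293225 *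
    y ^ 2 + 458316 / 1304293225 * y + 3346808 / 1304293225) * h
  have hres : r ^ 3 - 65 * r ^ 2 + 1313 * r - 8450 = 0 := by
    rw [show r ^ 3 = r * r ^ 2 by ring, hr2, hr]
    linear_combination (808 / 1304293225 * y ^ 4 - 67686 / 1304293225 * y ^ 3 + 27738 / 42073975 *
    y ^ 2 + 21996268 / 1304293225 * y + 160898647 / 1304293225) * h
  have hquad : y ^ 2 - 2 * y * (4 / 13 * r ^ 2 - 15 * r + 155) + (-55 / 13 * r ^ 2 + 202 * r - 2067)
    = 0 := by
    rw [hr2, hr]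
    linear_combination (56 / 469495) * h
  refine ⟨r, hres, ?_⟩
  linear_combination hquad + (-2500 / 44926453 * r ^ 3 + 41500 / 44926453 * r ^ 2 + 403584 /
  3455881 * r - 11599860 / 3455881) * hres

end Roots

/-- The quartic field cut out by this polynomial generates the splitting field of `F13`. -/
noncomputable def quarticResolvent : ℤ[X] :=
  X ^ 4 + 13 * X ^ 3 + 65 * X ^ 2 + 169 * X + 221

/-- The cubic resolvent of `quarticResolvent`. -/
noncomputable def cubicResolvent : ℤ[X] :=
  X ^ 3 - 65 * X ^ 2 + 1313 * X - 8450

theorem quarticResolvent_natDegree : quarticResolvent.natDegree = 4 := by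
  unfold quarticResolvent; compute_degree!

theorem quarticResolvent_monic : quarticResolvent.Monic := by
  unfold quarticResolvent; monicity!

theorem cubicResolvent_natDegree : cubicResolvent.natDegree = 3 := by
  unfold cubicResolvent; compute_degree!

theorem cubicResolvent_monic : cubicResolvent.Monic := by
  unfold cubicResolvent; monicity!

theorem quarticResolvent_irreducible : Irreducible quarticResolvent := by
  have hp : (Ideal.span {(13 : ℤ)}).IsPrime :=
    (Ideal.span_singleton_prime (by norm_num)).2 (by norm_num)
  refine IsEisensteinAt.irreducible (𝓟 := Ideal.span {(13 : ℤ)}) ⟨?_, ?_, ?_⟩ hp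
    quarticResolvent_monic.isPrimitive (by rw [quarticResolvent_natDegree]; norm_num)
  · rw [quarticResolvent_monic.leadingCoeff, Ideal.mem_span_singleton]
    norm_num
  · intro n hn
    rw [quarticResolvent_natDegree] at hn
    rw [Ideal.mem_span_singleton]
    unfold quarticResolvent
    interval_cases n <;> norm_num [coeff_X, coeff_ofNat_mul, coeff_ofNat_succ]
  · rw [Ideal.span_singleton_pow, Ideal.mem_span_singleton]
    unfold quarticResolvent
    norm_num [coeff_X, coeff_ofNat_mul]

theorem cubicResolvent_irreducible : Irreducible cubicResolvent := by
  rw [cubicResolvent_monic.irreducible_iff_roots_eq_zero_of_degree_le_three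
    (by rw [cubicResolvent_natDegree]; norm_num) (by rw [cubicResolvent_natDegree])]
  refine Multiset.eq_zero_of_forall_notMem fun n hn ↦ ?_
  have h : n ^ 3 - 65 * n ^ 2 + 1313 * n - 8450 = 0 := by
    simpa [cubicResolvent] using (mem_roots'.1 hn).2
  have h3 : (n : ZMod 3) ^ 3 - 65 * n ^ 2 + 1313 * n - 8450 = 0 := by
    exact_mod_cast congrArg (Int.cast : ℤ → ZMod 3) h
  generalize (n : ZMod 3) = m at h3
  revert m
  decide

section Splitting

variable {E : Type*} [Field E]

/-- The roots of `quarticResolvent`, presented through Vieta's relations. -/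
structure IsQuarticRoots (x : Fin 4 → E) : Prop where
  esymm_one : x 0 + x 1 + x 2 + x 3 = -13
  esymm_two : x 0 * x 1 + x 0 * x 2 + x 0 * x 3 + x 1 * x 2 + x 1 * x 3 + x 2 * x 3 = 65
  esymm_three : x 0 * x 1 * x 2 + x 0 * x 1 * x 3 + x 0 * x 2 * x 3 + x 1 * x 2 * x 3 = -169
  esymm_four : x 0 * x 1 * x 2 * x 3 = 221

theorem mem_rootSet_quarticResolvent [Algebra ℚ E] {t : E} :
    t ∈ (quarticResolvent.map (Int.castRingHom ℚ)).rootSet E ↔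
      t ^ 4 + 13 * t ^ 3 + 65 * t ^ 2 + 169 * t + 221 = 0 := by
  rw [mem_rootSet_of_ne (quarticResolvent_monic.map _).ne_zero]
  simp [quarticResolvent, aeval_def]

theorem exists_isQuarticRoots [Algebra ℚ E]
    (h : ((quarticResolvent.map (Int.castRingHom ℚ)).map (algebraMap ℚ E)).Splits) :
    ∃ x : Fin 4 → E, IsQuarticRoots x := by
  have : CharZero E := algebraRat.charZero E
  have hm := (quarticResolvent_monic.map (Int.castRingHom ℚ)).map (algebraMap ℚ E)
  set p := (quarticResolvent.map (Int.castRingHom ℚ)).map (algebraMap ℚ E) with hp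
  have hcard : p.roots.toList.length = 4 := by
    rw [Multiset.length_toList, ← h.natDegree_eq_card_roots, hp,
      (quarticResolvent_monic.map _).natDegree_map, quarticResolvent_monic.natDegree_map,
      quarticResolvent_natDegree]
  obtain ⟨a, b, c, d, hl⟩ := List.length_eq_four.1 hcard
  have key (t : E) : t ^ 4 + 13 * t ^ 3 + 65 * t ^ 2 + 169 * t + 221 =
      (t - a) * ((t - b) * ((t - c) * (t - d))) := by
    have := h.eval_eq_prod_roots_of_monic hm t
    rw [← Multiset.coe_toList p.roots, hl] at this
    simpa [hp, quarticResolvent] using this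
  have h0 := key 0
  have h1 := key 1
  have h2 := key (-1)
  have h3 := key 2
  refine ⟨![a, b, c, d], ?_, ?_, ?_, ?_⟩ <;>
    simp only [Matrix.cons_val]
  · linear_combination (1 / 6) * h3 + (1 / 4) * h0 * 2 - (1 / 2) * h1 - (1 / 6) * h2
  · linear_combination h0 - (1 / 2) * h1 - (1 / 2) * h2
  · linear_combination -(1 / 6) * h3 - (1 / 2) * h0 + h1 - (1 / 3) * h2
  · linear_combination -h0

namespace IsQuarticRoots

variable {x : Fin 4 → E}

theorem isRoot (hx : IsQuarticRoots x) (i : Fin 4) :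
    x i ^ 4 + 13 * x i ^ 3 + 65 * x i ^ 2 + 169 * x i + 221 = 0 := by
  obtain ⟨h1, h2, h3, h4⟩ := hx
  fin_cases i <;> simp only [Fin.reduceFinMk, Fin.zero_eta, Fin.mk_one]
  · linear_combination x 0 ^ 3 * h1 - x 0 ^ 2 * h2 + x 0 * h3 - h4
  · linear_combination x 1 ^ 3 * h1 - x 1 ^ 2 * h2 + x 1 * h3 - h4
  · linear_combination x 2 ^ 3 * h1 - x 2 ^ 2 * h2 + x 2 * h3 - h4
  · linear_combination x 3 ^ 3 * h1 - x 3 ^ 2 * h2 + x 3 * h3 - h4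

theorem exists_eq (hx : IsQuarticRoots x) {t : E}
    (ht : t ^ 4 + 13 * t ^ 3 + 65 * t ^ 2 + 169 * t + 221 = 0) : ∃ i, t = x i := by
  obtain ⟨h1, h2, h3, h4⟩ := hx
  have : (t - x 0) * (t - x 1) * (t - x 2) * (t - x 3) = 0 := by
    linear_combination ht - t ^ 3 * h1 + t ^ 2 * h2 - t * h3 + h4
  simp only [mul_eq_zero, sub_eq_zero] at this
  tauto

/-- Vieta's relations for the cubic resolvent. -/
theorem cubicResolvent_esymm (hx : IsQuarticRoots x) {r s t : E}
    (hr : r = x 0 * x 2 + x 1 * x 3) (hs : s = x 0 * x 1 + x 2 * x 3)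
    (ht : t = x 0 * x 3 + x 1 * x 2) :
    r + s + t = 65 ∧ r * s + s * t + t * r = 1313 ∧ r * s * t = 8450 := by
  obtain ⟨h1, h2, h3, h4⟩ := hx
  rw [hr, hs, ht]
  refine ⟨?_, ?_, ?_⟩
  · linear_combination h2
  · linear_combination (-169) * h1 + (x 0 + x 1 + x 2 + x 3) * h3 - 4 * h4
  · linear_combination (x 0 * x 1 * x 2 + x 0 * x 1 * x 3 + x 0 * x 2 * x 3 + x 1 * x 2 * x 3 -
      169) * h3 + 221 * (x 0 + x 1 + x 2 + x 3 - 13) * h1 + ((x 0 + x 1 + x 2 + x 3) ^ 2 -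
      4 * (x 0 * x 1 + x 0 * x 2 + x 0 * x 3 + x 1 * x 2 + x 1 * x 3 + x 2 * x 3)) * h4 - 884 * h2

theorem cubicResolvent_eq (hx : IsQuarticRoots x) (r : E) :
    r ^ 3 - 65 * r ^ 2 + 1313 * r - 8450 = (r - (x 0 * x 2 + x 1 * x 3)) *
      (r - (x 0 * x 1 + x 2 * x 3)) * (r - (x 0 * x 3 + x 1 * x 2)) := by
  obtain ⟨h1, h2, h3⟩ := hx.cubicResolvent_esymm rfl rfl rfl
  linear_combination r ^ 2 * h1 - r * h2 + h3

theorem det_vandermonde_sq (hx : IsQuarticRoots x) :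
    (Matrix.vandermonde x).det ^ 2 = 265837 := by
  obtain ⟨r, hr⟩ : ∃ r, r = x 0 * x 2 + x 1 * x 3 := ⟨_, rfl⟩
  obtain ⟨s, hs⟩ : ∃ s, s = x 0 * x 1 + x 2 * x 3 := ⟨_, rfl⟩
  obtain ⟨t, ht⟩ : ∃ t, t = x 0 * x 3 + x 1 * x 2 := ⟨_, rfl⟩
  obtain ⟨h1, h2, h3⟩ := hx.cubicResolvent_esymm hr hs ht
  have hdet : (Matrix.vandermonde x).det = -((s - t) * (r - s) * (r - t)) := by
    rw [Matrix.det_vandermonde, hr, hs, ht]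
    simp [Fin.prod_univ_succ, Fin.prod_Ioi_succ]
    ring
  rw [hdet]
  trans (r + s + t) ^ 2 * (r * s + s * t + t * r) ^ 2 - 4 * (r * s + s * t + t * r) ^ 3 -
    4 * (r + s + t) ^ 3 * (r * s * t) +
    18 * (r + s + t) * (r * s + s * t + t * r) * (r * s * t) - 27 * (r * s * t) ^ 2
  · ring
  · rw [h1, h2, h3]
    norm_num

theorem exists_sq_eq_thirteen [CharZero E] (hx : IsQuarticRoots x) (S : Subfield E)
    (hS : ∀ i, x i ∈ S) : ∃ w ∈ S, w ^ 2 - 13 = 0 := by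
  refine ⟨(Matrix.vandermonde x).det / 143, div_mem ?_ (ofNat_mem S 143), ?_⟩
  · rw [Matrix.det_vandermonde]
    exact prod_mem fun i _ ↦ prod_mem fun j _ ↦ sub_mem (hS j) (hS i)
  · linear_combination hx.det_vandermonde_sq / 143 ^ 2

theorem mem_of_octic [CharZero E] (hx : IsQuarticRoots x) (S : Subfield E)
    (hS : ∀ i, x i ∈ S) {y : E}
    (h : y ^ 8 + 42 * y ^ 7 + 905 * y ^ 6 + 11394 * y ^ 5 + 90820 * y ^ 4 + 402322 * y ^ 3 +
      797665 * y ^ 2 - 1631126 * y + 4782969 = 0) : y ∈ S := by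
  have of_factor {w : E} (hwS : w ∈ S) (hw : w ^ 2 - 13 = 0)
      (h : y ^ 4 + y ^ 3 * w + 21 * y ^ 3 + 67 / 2 * y ^ 2 * w + 477 / 2 * y ^ 2 + 382 * y * w +
        1124 * y + 2875 / 2 * w + 11251 / 2 = 0) : y ∈ S := by
    obtain ⟨a, ha, rfl⟩ := exists_quartic_root_of_octic_factor hw h
    obtain ⟨i, rfl⟩ := hx.exists_eq ha
    have := hS i
    repeat first
      | assumption
      | exact ofNat_mem S _
      | exact one_mem S
      | apply add_mem
      | apply sub_mem
      | apply neg_mem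
      | apply mul_mem
      | apply div_mem
      | apply pow_mem
  obtain ⟨w, hwS, hw⟩ := hx.exists_sq_eq_thirteen S hS
  rw [octic_eq_mul hw, mul_eq_zero] at h
  rcases h with h | h
  · exact of_factor hwS hw h
  · exact of_factor (neg_mem hwS) (by linear_combination hw) (by linear_combination h)

theorem cubicResolvent_roots (hx : IsQuarticRoots x) {r : E}
    (h : r ^ 3 - 65 * r ^ 2 + 1313 * r - 8450 = 0) :
    r = x 0 * x 2 + x 1 * x 3 ∨ r = x 0 * x 1 + x 2 * x 3 ∨ r = x 0 * x 3 + x 1 * x 2 := by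
  rw [hx.cubicResolvent_eq, mul_eq_zero, mul_eq_zero, sub_eq_zero, sub_eq_zero, sub_eq_zero] at h
  tauto

theorem mem_of_sextic [CharZero E] (hx : IsQuarticRoots x) (S : Subfield E)
    (hS : ∀ i, x i ∈ S) {y : E}
    (h : y ^ 6 + 36 * y ^ 5 + 508 * y ^ 4 + 3486 * y ^ 3 + 13236 * y ^ 2 + 33884 * y + 13 = 0) :
    y ∈ S := by
  obtain ⟨r, hr, hy⟩ := exists_resolvent_root_of_sextic h
  obtain ⟨hrS, v, hvS, hv⟩ : r ∈ S ∧ ∃ v ∈ S, v ^ 2 = 13 * r ^ 2 - 182 * r - 7943 := by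
    have aux {a b c d : E} (h : IsQuarticRoots ![a, b, c, d]) (ha : a ∈ S) (hb : b ∈ S)
        (hc : c ∈ S) (hd : d ∈ S) : a * c + b * d ∈ S ∧ ∃ v ∈ S,
          v ^ 2 = 13 * (a * c + b * d) ^ 2 - 182 * (a * c + b * d) - 7943 := by
      have hres := h.cubicResolvent_eq (a * c + b * d)
      obtain ⟨h1, h2, h3, h4⟩ := h
      simp only [Matrix.cons_val, sub_self, zero_mul] at hres h1 h2 h3 h4
      refine ⟨add_mem (mul_mem ha hc) (mul_mem hb hd), (a - c) * (b - d) * (a + c - b - d),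
        mul_mem (mul_mem (sub_mem ha hc) (sub_mem hb hd))
          (sub_mem (sub_mem (add_mem ha hc) hb) hd), ?_⟩
      obtain ⟨r, hr⟩ : ∃ r, r = a * c + b * d := ⟨_, rfl⟩
      have hsum : (a + c - b - d) ^ 2 = 4 * r - 91 := by
        rw [hr]
        linear_combination (a + b + c + d - 13) * h1 - 4 * h2
      have hprod : ((a - c) * (b - d)) ^ 2 = -3 * r ^ 2 + 130 * r - 1027 := by
        rw [hr]
        trans ((a * b + a * c + a * d + b * c + b * d + c * d) - (a * c + b * d)) ^ 2 -
          4 * ((a + b + c + d) * (a * b * c + a * b * d + a * c * d + b * c * d) -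
            4 * (a * b * c * d)) + 4 * (a * c + b * d) *
            ((a * b + a * c + a * d + b * c + b * d + c * d) - (a * c + b * d))
        · ring
        · rw [h1, h2, h3, h4]
          ring
      rw [← hr] at hres ⊢
      rw [mul_pow, hsum, hprod]
      linear_combination (-12) * hres
    obtain ⟨h1, h2, h3, h4⟩ := id hx
    rcases hx.cubicResolvent_roots hr with rfl | rfl | rfl
    · refine aux (b := x 1) (d := x 3) ⟨?_, ?_, ?_, ?_⟩ (hS _) (hS _) (hS _) (hS _) <;>
        simp only [Matrix.cons_val]
      exacts [by linear_combination h1, by linear_combination h2, by linear_combination h3,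
        by linear_combination h4]
    · refine aux (b := x 2) (d := x 3) ⟨?_, ?_, ?_, ?_⟩ (hS _) (hS _) (hS _) (hS _) <;>
        simp only [Matrix.cons_val]
      exacts [by linear_combination h1, by linear_combination h2, by linear_combination h3,
        by linear_combination h4]
    · refine aux (b := x 1) (d := x 2) ⟨?_, ?_, ?_, ?_⟩ (hS _) (hS _) (hS _) (hS _) <;>
        simp only [Matrix.cons_val]
      exacts [by linear_combination h1, by linear_combination h2, by linear_combination h3,
        by linear_combination h4]
  rw [← hv, ← mul_pow, sq_eq_sq_iff_eq_or_eq_neg] at hy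
  rcases hy with hy | hy <;> rw [sub_eq_iff_eq_add.1 hy]
  all_goals
    repeat first
      | assumption
      | exact ofNat_mem S _
      | exact one_mem S
      | apply add_mem
      | apply sub_mem
      | apply neg_mem
      | apply mul_mem
      | apply div_mem
      | apply pow_mem

end IsQuarticRoots

end Splitting

theorem quarticResolvent_map_irreducible :
    Irreducible (quarticResolvent.map (Int.castRingHom ℚ)) :=
  (quarticResolvent_monic.irreducible_iff_irreducible_map_fraction_map (K := ℚ)).1
    quarticResolvent_irreducible

theorem cubicResolvent_map_irreducible :
    Irreducible (cubicResolvent.map (Int.castRingHom ℚ)) :=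
  (cubicResolvent_monic.irreducible_iff_irreducible_map_fraction_map (K := ℚ)).1
    cubicResolvent_irreducible

theorem IsQuarticRoots.injective {E : Type*} [Field E] [CharZero E] {x : Fin 4 → E}
    (hx : IsQuarticRoots x) : Function.Injective x := by
  rw [← Matrix.det_vandermonde_ne_zero_iff]
  intro h
  have := hx.det_vandermonde_sq
  rw [h] at this
  norm_num at this

theorem twelve_dvd_finrank {E : Type*} [Field E] [Algebra ℚ E]
    (h : ((quarticResolvent.map (Int.castRingHom ℚ)).map (algebraMap ℚ E)).Splits) :
    12 ∣ Module.finrank ℚ E := by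
  obtain ⟨x, hx⟩ := exists_isQuarticRoots h
  have h4 : 4 ∣ Module.finrank ℚ E := by
    have := quarticResolvent_map_irreducible.natDegree_dvd_finrank h
    rwa [quarticResolvent_monic.natDegree_map, quarticResolvent_natDegree] at this
  have h3 : 3 ∣ Module.finrank ℚ E := by
    have hmin := minpoly.eq_of_irreducible_of_monic (x := x 0 * x 2 + x 1 * x 3)
      cubicResolvent_map_irreducible
      (by simpa [cubicResolvent, aeval_def] using hx.cubicResolvent_eq (x 0 * x 2 + x 1 * x 3))
      (cubicResolvent_monic.map _)
    have := minpoly.degree_dvd (K := ℚ) (x := x 0 * x 2 + x 1 * x 3)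
      (minpoly.ne_zero_iff.1 (hmin ▸ (cubicResolvent_monic.map _).ne_zero))
    rwa [← hmin, cubicResolvent_monic.natDegree_map, cubicResolvent_natDegree] at this
  exact Nat.Coprime.mul_dvd_of_dvd_of_dvd (m := 4) (n := 3) (by norm_num) h4 h3

/-- A Galois automorphism acts on the square root of the discriminant by the sign of the
permutation it induces on the roots. -/
theorem map_det_vandermonde {E : Type*} [Field E] {n : ℕ} (x : Fin n → E) (f : E →+* E)
    (π : Equiv.Perm (Fin n)) (h : ∀ i, f (x i) = x (π i)) :
    f (Matrix.vandermonde x).det = Equiv.Perm.sign π * (Matrix.vandermonde x).det := by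
  rw [← Matrix.det_permute, RingHom.map_det]
  congr 1
  ext i j
  simp [Matrix.vandermonde_apply, h]

theorem gal_quarticResolvent :
    Nonempty ((quarticResolvent.map (Int.castRingHom ℚ)).Gal ≃* Equiv.Perm (Fin 4)) := by
  classical
  set p := quarticResolvent.map (Int.castRingHom ℚ) with hp
  have hsplit := SplittingField.splits p
  have : Fact ((p.map (algebraMap ℚ p.SplittingField)).Splits) := ⟨hsplit⟩
  obtain ⟨x, hx⟩ := exists_isQuarticRoots hsplit
  have hmem (i : Fin 4) : x i ∈ p.rootSet p.SplittingField :=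
    mem_rootSet_quarticResolvent.2 (hx.isRoot i)
  let e : Fin 4 ≃ p.rootSet p.SplittingField := Equiv.ofBijective (fun i ↦ ⟨x i, hmem i⟩)
    ⟨fun i j h ↦ hx.injective (congrArg Subtype.val h), fun ⟨t, ht⟩ ↦ by
      obtain ⟨i, rfl⟩ := hx.exists_eq (mem_rootSet_quarticResolvent.1 ht)
      exact ⟨i, rfl⟩⟩
  let φ : p.Gal →* Equiv.Perm (Fin 4) :=
    e.symm.permCongrHom.toMonoidHom.comp (Gal.galActionHom p p.SplittingField)
  have hφ : Function.Injective φ :=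
    e.symm.permCongrHom.injective.comp (Gal.galActionHom_injective p p.SplittingField)
  have hcard : 12 ∣ Nat.card φ.range := by
    rw [← Nat.card_congr (MonoidHom.ofInjective hφ).toEquiv,
      Gal.card_of_separable quarticResolvent_map_irreducible.separable]
    exact twelve_dvd_finrank hsplit
  have hact (σ : Gal(p.SplittingField/ℚ)) (i : Fin 4) :
      σ (x i) = x (φ (Gal.restrict p p.SplittingField σ) i) := by
    refine (Gal.galActionHom_restrict p p.SplittingField σ (e i)).symm.trans ?_
    exact congrArg Subtype.val (e.apply_symm_apply _).symm
  have hodd : ¬ φ.range ≤ alternatingGroup (Fin 4) := by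
    intro hle
    have hfix : (Matrix.vandermonde x).det ∈ (⊥ : IntermediateField ℚ p.SplittingField) := by
      have : IsGalois ℚ p.SplittingField :=
        have : p.IsSplittingField ℚ p.SplittingField := by
          convert IsSplittingField.splittingField p
          exact Subsingleton.elim _ _
        IsGalois.of_separable_splitting_field (p := p)
          quarticResolvent_map_irreducible.separable
      rw [IsGalois.mem_bot_iff_fixed]
      intro σ
      have := map_det_vandermonde x (σ : p.SplittingField →+* p.SplittingField) _ (hact σ)
      rw [Equiv.Perm.mem_alternatingGroup.1 (hle ⟨_, rfl⟩)] at this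
      simpa using this
    obtain ⟨q, hq⟩ := IntermediateField.mem_bot.1 hfix
    have hsq : q ^ 2 = 265837 := by
      apply (algebraMap ℚ p.SplittingField).injective
      rw [map_pow, hq, hx.det_vandermonde_sq, map_ofNat]
    have : IsSquare (265837 : ℚ) := ⟨q, by rw [← hsq, sq]⟩
    rw [Rat.isSquare_iff] at this
    norm_num at this
  have htop : φ.range = ⊤ := by
    have hmul := φ.range.card_mul_index
    rw [Nat.card_eq_fintype_card (α := Equiv.Perm (Fin 4)), Fintype.card_perm,
      Fintype.card_fin] at hmul
    obtain ⟨k, hk⟩ := hcard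
    have h24 : k * φ.range.index = 2 := by
      rw [hk] at hmul
      have : Nat.factorial 4 = 24 := rfl
      linarith
    have : φ.range.index ∣ 2 := Dvd.intro_left _ h24
    rcases (Nat.dvd_prime Nat.prime_two).1 this with h | h
    · exact Subgroup.index_eq_one.1 h
    · exact absurd (Equiv.Perm.eq_alternatingGroup_of_index_eq_two h).le hodd
  exact ⟨MulEquiv.ofBijective φ ⟨hφ, MonoidHom.range_eq_top.1 htop⟩⟩

theorem F13_ne_zero : F13 ≠ 0 := by
  intro h
  have := congrArg (eval 0) h
  norm_num [F13, P13] at this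

theorem mem_rootSet_F13 {E : Type*} [Field E] [Algebra ℚ E] {t : E} :
    t ∈ F13.rootSet E ↔
      ((3 * t) ^ 6 + 36 * (3 * t) ^ 5 + 508 * (3 * t) ^ 4 + 3486 * (3 * t) ^ 3 +
        13236 * (3 * t) ^ 2 + 33884 * (3 * t) + 13) *
      ((3 * t) ^ 8 + 42 * (3 * t) ^ 7 + 905 * (3 * t) ^ 6 + 11394 * (3 * t) ^ 5 +
        90820 * (3 * t) ^ 4 + 402322 * (3 * t) ^ 3 + 797665 * (3 * t) ^ 2 -
        1631126 * (3 * t) + 4782969) = 0 := by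
  have : CharZero E := algebraRat.charZero E
  rw [mem_rootSet_of_ne F13_ne_zero]
  have : aeval t F13 =
      (((3 * t) ^ 6 + 36 * (3 * t) ^ 5 + 508 * (3 * t) ^ 4 + 3486 * (3 * t) ^ 3 +
        13236 * (3 * t) ^ 2 + 33884 * (3 * t) + 13) *
      ((3 * t) ^ 8 + 42 * (3 * t) ^ 7 + 905 * (3 * t) ^ 6 + 11394 * (3 * t) ^ 5 +
        90820 * (3 * t) ^ 4 + 402322 * (3 * t) ^ 3 + 797665 * (3 * t) ^ 2 -
        1631126 * (3 * t) + 4782969)) / 4782969 := by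
    simp [F13, P13, aeval_def]
    ring
  rw [this, div_eq_zero_iff]
  simp

theorem adjoin_rootSet_F13 (E : Type*) [Field E] [Algebra ℚ E] [IsAlgClosed E] :
    IntermediateField.adjoin ℚ (F13.rootSet E) =
      IntermediateField.adjoin ℚ ((quarticResolvent.map (Int.castRingHom ℚ)).rootSet E) := by
  have : CharZero E := algebraRat.charZero E
  obtain ⟨x, hx⟩ := exists_isQuarticRoots (E := E) (IsAlgClosed.splits _)
  apply le_antisymm
  · rw [IntermediateField.adjoin_le_iff]
    intro t ht
    set K := IntermediateField.adjoin ℚ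
      ((quarticResolvent.map (Int.castRingHom ℚ)).rootSet E) with hK
    have hS (i : Fin 4) : x i ∈ K.toSubfield :=
      IntermediateField.subset_adjoin _ _ (mem_rootSet_quarticResolvent.2 (hx.isRoot i))
    have h3 : 3 * t ∈ K.toSubfield := by
      rcases mul_eq_zero.1 (mem_rootSet_F13.1 ht) with h | h
      · exact hx.mem_of_sextic _ hS h
      · exact hx.mem_of_octic _ hS h
    have := div_mem h3 (ofNat_mem K.toSubfield 3)
    rwa [mul_div_cancel_left₀ _ (by norm_num : (3 : E) ≠ 0)] at this
  · rw [IntermediateField.adjoin_le_iff]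
    intro a ha
    have ha := mem_rootSet_quarticResolvent.1 ha
    set S := (IntermediateField.adjoin ℚ (F13.rootSet E)).toSubfield with hS
    have hoct {y : E} (h : y ^ 8 + 42 * y ^ 7 + 905 * y ^ 6 + 11394 * y ^ 5 + 90820 * y ^ 4 +
        402322 * y ^ 3 + 797665 * y ^ 2 - 1631126 * y + 4782969 = 0) : y ∈ S := by
      have : y / 3 ∈ S := IntermediateField.subset_adjoin _ _
        (mem_rootSet_F13.2 (by rw [mul_div_cancel₀ _ (by norm_num : (3 : E) ≠ 0), h, mul_zero]))
      have := mul_mem (ofNat_mem S 3) this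
      rwa [mul_div_cancel₀ _ (by norm_num : (3 : E) ≠ 0)] at this
    obtain ⟨w, -, hw⟩ := hx.exists_sq_eq_thirteen ⊤ fun _ ↦ Subfield.mem_top _
    have hw' : (-w) ^ 2 - 13 = 0 := by linear_combination hw
    have h1 := hoct (by rw [octic_eq_mul hw, octic_factor_of_quartic_root hw ha rfl, zero_mul])
    have h2 := hoct (by rw [octic_eq_mul hw', octic_factor_of_quartic_root hw' ha rfl, zero_mul])
    obtain ⟨u, hu⟩ : ∃ u, u = 5 * a ^ 3 + 41 * a ^ 2 + 132 * a + 230 := ⟨_, rfl⟩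
    have huS : u ∈ S := by
      convert add_mem h1 h2 using 1
      rw [hu]
      ring
    change a ∈ S
    rw [quartic_root_eq_of_octic_trace ha hu]
    repeat first
      | assumption
      | exact ofNat_mem S _
      | exact one_mem S
      | apply add_mem
      | apply sub_mem
      | apply neg_mem
      | apply mul_mem
      | apply div_mem
      | apply pow_mem

/-- The Galois group over `ℚ` of `F(X) = P(X) + (160855552000/1594323)·X` is isomorphic to the
symmetric group `S₄`. -/
theorem gal_F13_iso_S4 : Nonempty (F13.Gal ≃* Equiv.Perm (Fin 4)) := by
  obtain ⟨e⟩ := gal_quarticResolvent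
  set p := quarticResolvent.map (Int.castRingHom ℚ)
  set K := IntermediateField.adjoin ℚ (p.rootSet ℂ) with hK
  have : p.IsSplittingField ℚ K :=
    IntermediateField.adjoin_rootSet_isSplittingField (IsAlgClosed.splits _)
  have : F13.IsSplittingField ℚ K := by
    rw [hK, ← adjoin_rootSet_F13]
    exact IntermediateField.adjoin_rootSet_isSplittingField (IsAlgClosed.splits _)
  exact ⟨((IsSplittingField.algEquiv K F13).symm.trans
    (IsSplittingField.algEquiv K p)).autCongr.trans e⟩
end
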